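/- arXiv:1304.7443 — 2 statements merged into one kernel-verified Lean document; each statement's English description precedes it below -/
import Mathlib

section
/- Let p ≥ 2 and let t be an integer with 1 ≤ t ≤ p. There exists a constant C depending only on p and t such that for every axis-parallel closed rectangle τ = [x_0, x_0+h] × [y_0, y_0+k] (h, k > 0) and every function w that is (t+2)-times continuously differentiable on an open neighbourhood of τ: ‖∂_x (R^τ w)‖_{L²(τ)} ≤ C Σ_{r=0}^{t+1} h^{t+1−r} k^{r} ‖∂_x^{t+2−r} ∂_y^{r} w‖_{L²(τ)}, where R^τ w := I_p^τ(π_{p+1}^τ w − w) − (π_{p+1}^τ w − w); the analogous estimate holds for ∂_y(R^τ w) with the roles of h, k and of x, y interchanged. The constant C is independent of h, k and w. -/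
/-- The Legendre polynomial of degree `p`, given by Rodrigues' formula
`L_p(t) = (1/(2^p p!)) (d/dt)^p (t² − 1)^p`. -/
noncomputable def legendre (p : ℕ) : Polynomial ℝ :=
  Polynomial.C (1 / (2 ^ p * (Nat.factorial p) : ℝ)) *
    Polynomial.derivative^[p] ((Polynomial.X ^ 2 - 1) ^ p)

/-- The Gauß–Lobatto points of order `p`: `−1 = t_0 < t_1 < ⋯ < t_p = 1`, the zeros of
`(1 − t²) L_p'(t)`. -/
def IsGLNodes (p : ℕ) (t : Fin (p + 1) → ℝ) : Prop :=
  StrictMono t ∧ t 0 = -1 ∧ t (Fin.last p) = 1 ∧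
    ∀ i, (1 - t i ^ 2) * (Polynomial.derivative (legendre p)).eval (t i) = 0

/-- Evaluation of a bivariate polynomial at a point of `ℝ²`. -/
noncomputable def ev (q : MvPolynomial (Fin 2) ℝ) (z : ℝ × ℝ) : ℝ :=
  MvPolynomial.eval ![z.1, z.2] q

/-- `q ∈ Q_k`: degree at most `k` in each of the two variables. -/
def memQ (k : ℕ) (q : MvPolynomial (Fin 2) ℝ) : Prop :=
  q.degreeOf 0 ≤ k ∧ q.degreeOf 1 ≤ k

/-- The reference element `τ̂ = [−1,1]²`. -/
def refSq : Set (ℝ × ℝ) := Set.Icc (-1, -1) (1, 1)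

/-- `q` is the vertex-edge-cell interpolant of `v` into `Q_k(τ̂)`: it matches `v` at the
four vertices of `τ̂ = [−1,1]²`, has the same moments against `P_{k−2}` on each of the
four edges, and the same moments against `Q_{k−2}` on the cell. -/
def IsVEC (k : ℕ) (v : ℝ × ℝ → ℝ) (q : MvPolynomial (Fin 2) ℝ) : Prop :=
  memQ k q ∧
  (∀ a ∈ ({-1, 1} : Set ℝ), ∀ b ∈ ({-1, 1} : Set ℝ), ev q (a, b) = v (a, b)) ∧
  (∀ b ∈ ({-1, 1} : Set ℝ), ∀ r : Polynomial ℝ, r.natDegree ≤ k - 2 →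
    ∫ s in (-1 : ℝ)..1, (ev q (s, b) - v (s, b)) * r.eval s = 0) ∧
  (∀ a ∈ ({-1, 1} : Set ℝ), ∀ r : Polynomial ℝ, r.natDegree ≤ k - 2 →
    ∫ s in (-1 : ℝ)..1, (ev q (a, s) - v (a, s)) * r.eval s = 0) ∧
  (∀ r : MvPolynomial (Fin 2) ℝ, memQ (k - 2) r →
    ∫ x in (-1 : ℝ)..1, ∫ y in (-1 : ℝ)..1, (ev q (x, y) - v (x, y)) * ev r (x, y) = 0)

/-- `q ∈ Q_k(τ̂)` is the tensor-product Lagrange interpolant of `v` at the grid of the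
nodes `s_0,…,s_k`. -/
def IsLag (k : ℕ) (s : Fin (k + 1) → ℝ) (v : ℝ × ℝ → ℝ) (q : MvPolynomial (Fin 2) ℝ) :
    Prop :=
  memQ k q ∧ ∀ i j, ev q (s i, s j) = v (s i, s j)

/-- The affine reference mapping `F_τ : τ̂ = [−1,1]² → τ = [x₀,x₀+h] × [y₀,y₀+k]`. -/
noncomputable def Fmap (x0 y0 h k : ℝ) (z : ℝ × ℝ) : ℝ × ℝ :=
  (x0 + h * (z.1 + 1) / 2, y0 + k * (z.2 + 1) / 2)

/-- The inverse of the affine reference mapping `F_τ`. -/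
noncomputable def Finv (x0 y0 h k : ℝ) (z : ℝ × ℝ) : ℝ × ℝ :=
  (2 * (z.1 - x0) / h - 1, 2 * (z.2 - y0) / k - 1)

/-- Partial derivative in the first variable. -/
noncomputable def pdx (f : ℝ × ℝ → ℝ) : ℝ × ℝ → ℝ :=
  fun z => deriv (fun s => f (s, z.2)) z.1

/-- Partial derivative in the second variable. -/
noncomputable def pdy (f : ℝ × ℝ → ℝ) : ℝ × ℝ → ℝ :=
  fun z => deriv (fun s => f (z.1, s)) z.2

/-- The `L²`-norm over the set `S`. -/
noncomputable def l2norm (S : Set (ℝ × ℝ)) (f : ℝ × ℝ → ℝ) : ℝ :=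
  Real.sqrt (∫ z in S, (f z) ^ 2)

section

open Set MeasureTheory

/-- The integral over the reference square `[−1,1]²`, as an iterated integral. -/
noncomputable def sqInt (f : ℝ × ℝ → ℝ) : ℝ :=
  ∫ x in (-1 : ℝ)..1, ∫ y in (-1 : ℝ)..1, f (x, y)

/-- `D a b` plays the role of `∂_x^a ∂_y^b (D 0 0)` on the reference square, for `a + b ≤ n`. -/
structure IsJet (n : ℕ) (D : ℕ → ℕ → ℝ × ℝ → ℝ) : Prop where
  cont : ∀ a b, a + b ≤ n → Continuous (D a b)
  dx : ∀ a b, a + b < n → ∀ x ∈ Ioo (-1 : ℝ) 1, ∀ y ∈ Icc (-1 : ℝ) 1,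
    HasDerivAt (fun s => D a b (s, y)) (D (a + 1) b (x, y)) x
  dy : ∀ a b, a + b < n → ∀ x ∈ Icc (-1 : ℝ) 1, ∀ y ∈ Ioo (-1 : ℝ) 1,
    HasDerivAt (fun s => D a b (x, s)) (D a (b + 1) (x, y)) y

lemma abs_sub_le_integral_abs_deriv {f f' : ℝ → ℝ} (hf : Continuous f) (hf' : Continuous f')
    (hd : ∀ x ∈ Ioo (-1 : ℝ) 1, HasDerivAt f (f' x) x) {x x' : ℝ}
    (hx : x ∈ Icc (-1 : ℝ) 1) (hx' : x' ∈ Icc (-1 : ℝ) 1) :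
    |f x - f x'| ≤ ∫ s in (-1 : ℝ)..1, |f' s| := by
  wlog h : x' ≤ x generalizing x x'
  · rw [abs_sub_comm]
    exact this hx' hx (le_of_not_ge h)
  have hftc : ∫ s in x'..x, f' s = f x - f x' :=
    intervalIntegral.integral_eq_sub_of_hasDerivAt_of_le h hf.continuousOn
      (fun s hs => hd s ⟨hx'.1.trans_lt hs.1, hs.2.trans_le hx.2⟩) (hf'.intervalIntegrable _ _)
  rw [← hftc]
  refine (intervalIntegral.abs_integral_le_integral_abs h).trans ?_
  exact intervalIntegral.integral_mono_interval hx'.1 h hx.2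
    (Filter.Eventually.of_forall fun s => abs_nonneg _) (hf'.abs.intervalIntegrable _ _)

lemma two_mul_abs_le_integral {f f' : ℝ → ℝ} (hf : Continuous f) (hf' : Continuous f')
    (hd : ∀ x ∈ Ioo (-1 : ℝ) 1, HasDerivAt f (f' x) x) {x : ℝ} (hx : x ∈ Icc (-1 : ℝ) 1) :
    2 * |f x| ≤ (∫ s in (-1 : ℝ)..1, |f s|) + 2 * ∫ s in (-1 : ℝ)..1, |f' s| := by
  have h : ∫ _ in (-1 : ℝ)..1, |f x| ≤
      ∫ s in (-1 : ℝ)..1, (|f s| + ∫ r in (-1 : ℝ)..1, |f' r|) := by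
    refine intervalIntegral.integral_mono_on (by norm_num) (by simp)
      ((hf.abs.add continuous_const).intervalIntegrable _ _) fun s hs => ?_
    have h1 := abs_sub_le_integral_abs_deriv hf hf' hd hx hs
    have h2 := abs_sub_abs_le_abs_sub (f x) (f s)
    linarith
  rw [intervalIntegral.integral_add (hf.abs.intervalIntegrable _ _) (by simp)] at h
  simp only [intervalIntegral.integral_const, smul_eq_mul] at h
  linarith

lemma continuous_integral_right {f : ℝ × ℝ → ℝ} (hf : Continuous f) :
    Continuous fun x => ∫ y in (-1 : ℝ)..1, f (x, y) :=
  intervalIntegral.continuous_parametric_intervalIntegral_of_continuous' (by fun_prop) _ _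

lemma continuous_integral_left {f : ℝ × ℝ → ℝ} (hf : Continuous f) :
    Continuous fun y => ∫ x in (-1 : ℝ)..1, f (x, y) :=
  intervalIntegral.continuous_parametric_intervalIntegral_of_continuous'
    (f := fun y x => f (x, y)) (by fun_prop) _ _

lemma sqInt_swap {f : ℝ × ℝ → ℝ} (hf : Continuous f) :
    sqInt f = ∫ y in (-1 : ℝ)..1, ∫ x in (-1 : ℝ)..1, f (x, y) := by
  have h : (-1 : ℝ) ≤ 1 := by norm_num
  simp only [sqInt, intervalIntegral.integral_of_le h]
  refine integral_integral_swap (f := fun x y => f (x, y)) ?_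
  rw [Measure.prod_restrict]
  exact (hf.continuousOn.integrableOn_compact (isCompact_Icc.prod isCompact_Icc)).mono_set
    (prod_mono Ioc_subset_Icc_self Ioc_subset_Icc_self)

lemma sqInt_add {f g : ℝ × ℝ → ℝ} (hf : Continuous f) (hg : Continuous g) :
    sqInt (fun z => f z + g z) = sqInt f + sqInt g := by
  unfold sqInt
  rw [← intervalIntegral.integral_add ((continuous_integral_right hf).intervalIntegrable _ _)
    ((continuous_integral_right hg).intervalIntegrable _ _)]
  congr 1
  ext x
  exact intervalIntegral.integral_add (Continuous.intervalIntegrable (by fun_prop) _ _)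
    (Continuous.intervalIntegrable (by fun_prop) _ _)

lemma sqInt_const_mul (c : ℝ) (f : ℝ × ℝ → ℝ) :
    sqInt (fun z => c * f z) = c * sqInt f := by
  simp [sqInt]

lemma sqInt_const (c : ℝ) : sqInt (fun _ => c) = 4 * c := by
  simp [sqInt]
  ring

lemma sqInt_mono {f g : ℝ × ℝ → ℝ} (hf : Continuous f) (hg : Continuous g)
    (h : ∀ z ∈ Icc (-1 : ℝ) 1 ×ˢ Icc (-1 : ℝ) 1, f z ≤ g z) : sqInt f ≤ sqInt g := by
  refine intervalIntegral.integral_mono_on (by norm_num)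
    ((continuous_integral_right hf).intervalIntegrable _ _)
    ((continuous_integral_right hg).intervalIntegrable _ _) fun x hx => ?_
  exact intervalIntegral.integral_mono_on (by norm_num)
    (Continuous.intervalIntegrable (by fun_prop) _ _)
    (Continuous.intervalIntegrable (by fun_prop) _ _) fun y hy => h _ ⟨hx, hy⟩

/-- The `L¹` Poincaré inequality on the square. -/
lemma sqInt_abs_le_of_mean_zero {f fx fy : ℝ × ℝ → ℝ} (hf : Continuous f) (hfx : Continuous fx)
    (hfy : Continuous fy)
    (hdx : ∀ x ∈ Ioo (-1 : ℝ) 1, ∀ y ∈ Icc (-1 : ℝ) 1,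
      HasDerivAt (fun s => f (s, y)) (fx (x, y)) x)
    (hdy : ∀ x ∈ Icc (-1 : ℝ) 1, ∀ y ∈ Ioo (-1 : ℝ) 1,
      HasDerivAt (fun s => f (x, s)) (fy (x, y)) y)
    (h0 : sqInt f = 0) :
    sqInt (fun z => |f z|) ≤ 2 * (sqInt (fun z => |fx z|) + sqInt (fun z => |fy z|)) := by
  set A : ℝ → ℝ := fun y => ∫ s in (-1 : ℝ)..1, |fx (s, y)| with hA
  set B : ℝ → ℝ := fun x => ∫ s in (-1 : ℝ)..1, |fy (x, s)| with hB
  have cA : Continuous A := continuous_integral_left hfx.abs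
  have cB : Continuous B := continuous_integral_right hfy.abs
  have key : ∀ z ∈ Icc (-1 : ℝ) 1 ×ˢ Icc (-1 : ℝ) 1, ∀ z' ∈ Icc (-1 : ℝ) 1 ×ˢ Icc (-1 : ℝ) 1,
      |f z - f z'| ≤ A z.2 + B z'.1 := by
    rintro ⟨x, y⟩ ⟨hx, hy⟩ ⟨x', y'⟩ ⟨hx', hy'⟩
    have h1 := abs_sub_le_integral_abs_deriv (f := fun s => f (s, y)) (f' := fun s => fx (s, y))
      (by fun_prop) (by fun_prop) (fun s hs => hdx s hs y hy) hx hx'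
    have h2 := abs_sub_le_integral_abs_deriv (f := fun s => f (x', s)) (f' := fun s => fy (x', s))
      (by fun_prop) (by fun_prop) (fun s hs => hdy x' hx' s hs) hy hy'
    exact (abs_sub_le _ (f (x', y)) _).trans (add_le_add h1 h2)
  have hBint : sqInt (fun z => B z.1) = 2 * sqInt (fun z => |fy z|) := by
    simp only [sqInt, hB, intervalIntegral.integral_const, smul_eq_mul,
      intervalIntegral.integral_const_mul]
    norm_num
  have hAint : sqInt (fun z => A z.2) = 2 * sqInt (fun z => |fx z|) := by
    rw [sqInt_swap hfx.abs]
    simp only [sqInt, hA, intervalIntegral.integral_const, smul_eq_mul]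
    norm_num
  have pt : ∀ z ∈ Icc (-1 : ℝ) 1 ×ˢ Icc (-1 : ℝ) 1,
      |f z| ≤ A z.2 + 1 / 2 * sqInt (fun z => |fy z|) := by
    intro z hz
    have h1 : sqInt (fun z' => f z + -1 * f z') ≤ sqInt (fun z' => A z.2 + B z'.1) :=
      sqInt_mono (by fun_prop) (by fun_prop) fun z' hz' => by
        linarith [(abs_le.1 (key z hz z' hz')).2]
    have h2 : sqInt (fun z' => -f z + f z') ≤ sqInt (fun z' => A z.2 + B z'.1) :=
      sqInt_mono (by fun_prop) (by fun_prop) fun z' hz' => by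
        linarith [(abs_le.1 (key z hz z' hz')).1]
    rw [sqInt_add (by fun_prop) (by fun_prop), sqInt_add (by fun_prop) (by fun_prop),
      sqInt_const, sqInt_const, sqInt_const_mul, h0, hBint] at h1
    rw [sqInt_add (by fun_prop) (by fun_prop), sqInt_add (by fun_prop) (by fun_prop),
      sqInt_const, sqInt_const, h0, hBint] at h2
    rw [abs_le]
    constructor <;> linarith
  have h3 := sqInt_mono hf.abs (by fun_prop) pt
  rw [sqInt_add (by fun_prop) (by fun_prop), sqInt_const, hAint] at h3
  linarith

/-- A Sobolev inequality on the square, with the mixed second derivative. -/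
lemma four_mul_abs_le_sqInt {f fx fy fxy : ℝ × ℝ → ℝ} (hf : Continuous f) (hfx : Continuous fx)
    (hfy : Continuous fy) (hfxy : Continuous fxy)
    (hdx : ∀ x ∈ Ioo (-1 : ℝ) 1, ∀ y ∈ Icc (-1 : ℝ) 1,
      HasDerivAt (fun s => f (s, y)) (fx (x, y)) x)
    (hdy : ∀ x ∈ Icc (-1 : ℝ) 1, ∀ y ∈ Ioo (-1 : ℝ) 1,
      HasDerivAt (fun s => f (x, s)) (fy (x, y)) y)
    (hdxy : ∀ x ∈ Icc (-1 : ℝ) 1, ∀ y ∈ Ioo (-1 : ℝ) 1,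
      HasDerivAt (fun s => fx (x, s)) (fxy (x, y)) y)
    {z : ℝ × ℝ} (hz : z ∈ Icc (-1 : ℝ) 1 ×ˢ Icc (-1 : ℝ) 1) :
    4 * |f z| ≤ sqInt (fun z => |f z|) + 2 * sqInt (fun z => |fx z|) +
      2 * sqInt (fun z => |fy z|) + 4 * sqInt (fun z => |fxy z|) := by
  obtain ⟨x, y⟩ := z
  obtain ⟨hx, hy⟩ := hz
  have slice : ∀ g gy : ℝ × ℝ → ℝ, Continuous g → Continuous gy →
      (∀ x ∈ Icc (-1 : ℝ) 1, ∀ y ∈ Ioo (-1 : ℝ) 1,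
        HasDerivAt (fun s => g (x, s)) (gy (x, y)) y) →
      2 * ∫ s in (-1 : ℝ)..1, |g (s, y)| ≤
        sqInt (fun z => |g z|) + 2 * sqInt (fun z => |gy z|) := by
    intro g gy hg hgy hd
    have c1 := continuous_integral_right hg.abs
    have c2 := continuous_integral_right hgy.abs
    simp only [sqInt]
    rw [← intervalIntegral.integral_const_mul, ← intervalIntegral.integral_const_mul,
      ← intervalIntegral.integral_add (c1.intervalIntegrable _ _)
        (Continuous.intervalIntegrable (by fun_prop) _ _)]
    exact intervalIntegral.integral_mono_on (by norm_num)
      (Continuous.intervalIntegrable (by fun_prop) _ _)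
      ((c1.add (continuous_const.mul c2)).intervalIntegrable _ _) fun s hs =>
        two_mul_abs_le_integral (f := fun r => g (s, r)) (f' := fun r => gy (s, r))
          (by fun_prop) (by fun_prop) (fun r hr => hd s hs r hr) hy
  have h1 := two_mul_abs_le_integral (f := fun s => f (s, y)) (f' := fun s => fx (s, y))
      (by fun_prop) (by fun_prop) (fun s hs => hdx s hs y hy) hx
  have h2 := slice f fy hf hfy hdy
  have h3 := slice fx fxy hfx hfxy hdxy
  simp only at h1
  linarith

/-- The space `Q_k` of real polynomial functions of degree at most `k` in each variable. -/
def tensorPoly (k : ℕ) : Submodule ℝ (ℝ × ℝ → ℝ) :=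
  Submodule.span ℝ {f | ∃ a ≤ k, ∃ b ≤ k, f = fun z => z.1 ^ a * z.2 ^ b}

lemma monomial_mem_tensorPoly {k a b : ℕ} (ha : a ≤ k) (hb : b ≤ k) :
    (fun z : ℝ × ℝ => z.1 ^ a * z.2 ^ b) ∈ tensorPoly k :=
  Submodule.subset_span ⟨a, ha, b, hb, rfl⟩

lemma tensorPoly_mono {k l : ℕ} (h : k ≤ l) : tensorPoly k ≤ tensorPoly l :=
  Submodule.span_mono fun _ ⟨a, ha, b, hb, e⟩ => ⟨a, ha.trans h, b, hb.trans h, e⟩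

lemma continuous_of_mem_tensorPoly {k : ℕ} {Q : ℝ × ℝ → ℝ} (hQ : Q ∈ tensorPoly k) :
    Continuous Q := by
  induction hQ using Submodule.span_induction with
  | mem f hf =>
    obtain ⟨a, -, b, -, rfl⟩ := hf
    fun_prop
  | zero => exact continuous_const
  | add f g _ _ hf hg => exact hf.add hg
  | smul c f _ hf => exact hf.const_smul c

/-- A polynomial function has an antiderivative in `x` which is a polynomial function. -/
lemma exists_antideriv_tensorPoly {k : ℕ} {q : ℝ × ℝ → ℝ} (hq : q ∈ tensorPoly k) :
    ∃ V ∈ tensorPoly (k + 1), ∀ x y, HasDerivAt (fun s => V (s, y)) (q (x, y)) x := by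
  induction hq using Submodule.span_induction with
  | mem f hf =>
    obtain ⟨a, ha, b, hb, rfl⟩ := hf
    refine ⟨((a : ℝ) + 1)⁻¹ • fun z => z.1 ^ (a + 1) * z.2 ^ b,
      Submodule.smul_mem _ _ (monomial_mem_tensorPoly (by omega) (by omega)), fun x y => ?_⟩
    have h := (((hasDerivAt_pow (a + 1) x).mul_const (y ^ b)).const_mul ((a : ℝ) + 1)⁻¹)
    refine h.congr_deriv ?_
    have : (a : ℝ) + 1 ≠ 0 := by positivity
    push_cast
    field_simp
  | zero => exact ⟨0, Submodule.zero_mem _, fun x y => hasDerivAt_const _ _⟩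
  | add f g _ _ hf hg =>
    obtain ⟨V, hV, hV'⟩ := hf
    obtain ⟨W, hW, hW'⟩ := hg
    exact ⟨V + W, Submodule.add_mem _ hV hW, fun x y => (hV' x y).add (hW' x y)⟩
  | smul c f _ hf =>
    obtain ⟨V, hV, hV'⟩ := hf
    exact ⟨c • V, Submodule.smul_mem _ _ hV, fun x y => (hV' x y).const_mul c⟩

/-- The `a`-th derivative of the Taylor monomial `x ^ n / n!`. -/
noncomputable def taylorMon (n a : ℕ) (x : ℝ) : ℝ :=
  if a ≤ n then x ^ (n - a) / (n - a).factorial else 0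

lemma continuous_taylorMon (n a : ℕ) : Continuous (taylorMon n a) := by
  unfold taylorMon
  split_ifs <;> fun_prop

lemma hasDerivAt_taylorMon (n a : ℕ) (x : ℝ) :
    HasDerivAt (taylorMon n a) (taylorMon n (a + 1) x) x := by
  unfold taylorMon
  rcases lt_trichotomy a n with h | rfl | h
  · obtain ⟨d, rfl⟩ := Nat.exists_eq_add_of_lt h
    have e1 : a + d + 1 - a = d + 1 := by omega
    have e2 : a + d + 1 - (a + 1) = d := by omega
    simp only [if_pos h.le, if_pos (Nat.succ_le_of_lt h), e1, e2]
    refine ((hasDerivAt_pow (d + 1) x).div_const _).congr_deriv ?_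
    rw [Nat.factorial_succ]
    have : (d.factorial : ℝ) ≠ 0 := by positivity
    push_cast
    field_simp
  · simpa using hasDerivAt_const x (1 : ℝ)
  · simpa [h.not_ge, (Nat.lt_succ_of_lt h).not_ge] using hasDerivAt_const x (0 : ℝ)

lemma taylorMon_self (n : ℕ) (x : ℝ) : taylorMon n n x = 1 := by simp [taylorMon]

lemma taylorMon_of_lt {n a : ℕ} (h : n < a) (x : ℝ) : taylorMon n a x = 0 := by
  simp [taylorMon, h.not_ge]

lemma isJet_taylorMon (n i j : ℕ) :
    IsJet n fun a b z => taylorMon i a z.1 * taylorMon j b z.2 where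
  cont a b _ := ((continuous_taylorMon i a).comp continuous_fst).mul
    ((continuous_taylorMon j b).comp continuous_snd)
  dx a b _ x _ y _ := (hasDerivAt_taylorMon i a x).mul_const (taylorMon j b y)
  dy a b _ x _ y _ := (hasDerivAt_taylorMon j b y).const_mul (taylorMon i a x)

lemma IsJet.sub {n : ℕ} {D E : ℕ → ℕ → ℝ × ℝ → ℝ} (hD : IsJet n D) (hE : IsJet n E) :
    IsJet n fun a b z => D a b z - E a b z where
  cont a b h := (hD.cont a b h).sub (hE.cont a b h)
  dx a b h x hx y hy := (hD.dx a b h x hx y hy).sub (hE.dx a b h x hx y hy)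
  dy a b h x hx y hy := (hD.dy a b h x hx y hy).sub (hE.dy a b h x hx y hy)

lemma IsJet.const_mul {n : ℕ} {D : ℕ → ℕ → ℝ × ℝ → ℝ} (hD : IsJet n D) (c : ℝ) :
    IsJet n fun a b z => c * D a b z where
  cont a b h := continuous_const.mul (hD.cont a b h)
  dx a b h x hx y hy := (hD.dx a b h x hx y hy).const_mul c
  dy a b h x hx y hy := (hD.dy a b h x hx y hy).const_mul c

lemma IsJet.sum {ι : Type*} (s : Finset ι) {n : ℕ} {D : ι → ℕ → ℕ → ℝ × ℝ → ℝ}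
    (hD : ∀ i ∈ s, IsJet n (D i)) : IsJet n fun a b z => ∑ i ∈ s, D i a b z where
  cont a b h := continuous_finsetSum _ fun i hi => (hD i hi).cont a b h
  dx a b h x hx y hy := HasDerivAt.fun_sum fun i hi => (hD i hi).dx a b h x hx y hy
  dy a b h x hx y hy := HasDerivAt.fun_sum fun i hi => (hD i hi).dy a b h x hx y hy

lemma IsJet.shift {n : ℕ} {D : ℕ → ℕ → ℝ × ℝ → ℝ} (hD : IsJet (n + 1) D) :
    IsJet n fun a b => D (a + 1) b where
  cont a b h := hD.cont _ _ (by omega)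
  dx a b h := hD.dx _ _ (by omega)
  dy a b h := hD.dy _ _ (by omega)

/-- The sum of the `L¹`-norms of the entries of order `n`. -/
noncomputable def jetNorm (n : ℕ) (D : ℕ → ℕ → ℝ × ℝ → ℝ) : ℝ :=
  ∑ r ∈ Finset.range (n + 1), sqInt fun z => |D (n - r) r z|

lemma sqInt_abs_nonneg {f : ℝ × ℝ → ℝ} : 0 ≤ sqInt fun z => |f z| :=
  intervalIntegral.integral_nonneg (by norm_num) fun _ _ =>
    intervalIntegral.integral_nonneg (by norm_num) fun _ _ => abs_nonneg _

lemma jetNorm_nonneg (n : ℕ) (D : ℕ → ℕ → ℝ × ℝ → ℝ) : 0 ≤ jetNorm n D :=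
  Finset.sum_nonneg fun _ _ => sqInt_abs_nonneg

lemma IsJet.sqInt_abs_le {n : ℕ} {D : ℕ → ℕ → ℝ × ℝ → ℝ} (hD : IsJet n D)
    (h0 : ∀ a b, a + b < n → sqInt (D a b) = 0) (d : ℕ) :
    ∀ a b, a + b + d = n → sqInt (fun z => |D a b z|) ≤ 4 ^ d * jetNorm n D := by
  induction d with
  | zero =>
    intro a b h
    have e : a = n - b := by omega
    subst e
    rw [pow_zero, one_mul]
    exact Finset.single_le_sum (f := fun r => sqInt fun z => |D (n - r) r z|)
      (fun _ _ => sqInt_abs_nonneg) (Finset.mem_range.2 (by omega))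
  | succ d ih =>
    intro a b h
    have h1 := ih (a + 1) b (by omega)
    have h2 := ih a (b + 1) (by omega)
    have h3 := sqInt_abs_le_of_mean_zero (hD.cont a b (by omega)) (hD.cont (a + 1) b (by omega))
      (hD.cont a (b + 1) (by omega)) (hD.dx a b (by omega)) (hD.dy a b (by omega))
      (h0 a b (by omega))
    rw [pow_succ]
    linarith

lemma IsJet.abs_le_of_mean_zero {n : ℕ} (hn : 2 ≤ n) {D : ℕ → ℕ → ℝ × ℝ → ℝ} (hD : IsJet n D)
    (h0 : ∀ a b, a + b < n → sqInt (D a b) = 0) {z : ℝ × ℝ}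
    (hz : z ∈ Icc (-1 : ℝ) 1 ×ˢ Icc (-1 : ℝ) 1) :
    |D 0 0 z| ≤ 4 ^ (n + 1) * jetNorm n D := by
  have bd : ∀ a b, a + b ≤ 2 → sqInt (fun z => |D a b z|) ≤ 4 ^ n * jetNorm n D := by
    intro a b h
    refine (hD.sqInt_abs_le h0 (n - (a + b)) a b (by omega)).trans ?_
    exact mul_le_mul_of_nonneg_right (pow_le_pow_right₀ (by norm_num) (by omega))
      (jetNorm_nonneg _ _)
  have h := four_mul_abs_le_sqInt (hD.cont 0 0 (by omega)) (hD.cont 1 0 (by omega))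
    (hD.cont 0 1 (by omega)) (hD.cont 1 1 (by omega)) (hD.dx 0 0 (by omega))
    (hD.dy 0 0 (by omega)) (hD.dy 1 0 (by omega)) hz
  have h1 := bd 0 0 (by omega)
  have h2 := bd 1 0 (by omega)
  have h3 := bd 0 1 (by omega)
  have h4 := bd 1 1 (by omega)
  have h5 : 0 ≤ 4 ^ n * jetNorm n D := mul_nonneg (by positivity) (jetNorm_nonneg _ _)
  rw [pow_succ]
  linarith

lemma IsJet.exists_abs_sub_le_of_mean_zero {n : ℕ} (hn : 2 ≤ n) (j : ℕ) (hj : j ≤ n) :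
    ∀ D : ℕ → ℕ → ℝ × ℝ → ℝ, IsJet n D →
      (∀ a b, j ≤ a + b → a + b < n → sqInt (D a b) = 0) →
      ∃ q ∈ tensorPoly (n - 1), ∀ z ∈ Icc (-1 : ℝ) 1 ×ˢ Icc (-1 : ℝ) 1,
        |D 0 0 z - q z| ≤ 4 ^ (n + 1) * jetNorm n D := by
  induction j with
  | zero =>
    intro D hD h0
    refine ⟨0, Submodule.zero_mem _, fun z hz => ?_⟩
    simpa using hD.abs_le_of_mean_zero hn (fun a b h => h0 a b (Nat.zero_le _) h) hz
  | succ j ih =>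
    intro D hD h0
    set E : ℕ → ℕ → ℕ → ℝ × ℝ → ℝ := fun i a b z =>
      (sqInt (D (j - i) i) / 4) * (taylorMon (j - i) a z.1 * taylorMon i b z.2) with hE
    set P : ℕ → ℕ → ℝ × ℝ → ℝ := fun a b z => ∑ i ∈ Finset.range (j + 1), E i a b z with hP
    have hPjet : IsJet n P := IsJet.sum _ fun i _ => (isJet_taylorMon n (j - i) i).const_mul _
    have hPgt : ∀ a b, j < a + b → ∀ z, P a b z = 0 := by
      intro a b hab z
      refine Finset.sum_eq_zero fun i hi => ?_
      rw [Finset.mem_range] at hi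
      rcases Nat.lt_or_ge (j - i) a with h | h
      · simp [hE, taylorMon_of_lt h]
      · simp [hE, taylorMon_of_lt (show i < b by omega)]
    have hPeq : ∀ a b, a + b = j → ∀ z, P a b z = sqInt (D a b) / 4 := by
      intro a b hab z
      rw [hP]
      simp only
      rw [Finset.sum_eq_single b]
      · have e : j - b = a := by omega
        simp [hE, e, taylorMon_self]
      · intro i hi hib
        rw [Finset.mem_range] at hi
        rcases Nat.lt_or_ge (j - i) a with h | h
        · simp [hE, taylorMon_of_lt h]
        · simp [hE, taylorMon_of_lt (show i < b by omega)]
      · intro hb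
        exact absurd (Finset.mem_range.2 (by omega)) hb
    obtain ⟨q, hq, hq'⟩ := ih (by omega) _ (hD.sub hPjet) (by
      intro a b h1 h2
      rcases h1.eq_or_lt with h | h
      · have e : (fun z => D a b z - P a b z) = fun z => D a b z + -(sqInt (D a b) / 4) := by
          ext z
          rw [hPeq a b h.symm z]
          ring
        rw [e, sqInt_add (hD.cont a b h2.le) continuous_const, sqInt_const]
        ring
      · have e : (fun z => D a b z - P a b z) = D a b := by
          ext z
          rw [hPgt a b h z, sub_zero]
        rw [e]
        exact h0 a b h h2)
    have hnorm : jetNorm n (fun a b z => D a b z - P a b z) = jetNorm n D := by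
      refine Finset.sum_congr rfl fun r hr => ?_
      rw [Finset.mem_range] at hr
      congr 1
      ext z
      simp only [hPgt (n - r) r (by omega) z, sub_zero]
    have hP0 : P 0 0 ∈ tensorPoly (n - 1) := by
      have e : P 0 0 = ∑ i ∈ Finset.range (j + 1),
          (sqInt (D (j - i) i) / 4 / (j - i).factorial / i.factorial) •
            fun z : ℝ × ℝ => z.1 ^ (j - i) * z.2 ^ i := by
        ext z
        simp only [hP, hE, taylorMon, Finset.sum_apply, Pi.smul_apply, smul_eq_mul, Nat.zero_le,
          if_true, Nat.sub_zero]
        refine Finset.sum_congr rfl fun i _ => ?_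
        ring
      rw [e]
      refine Submodule.sum_mem _ fun i hi => Submodule.smul_mem _ _ ?_
      rw [Finset.mem_range] at hi
      exact monomial_mem_tensorPoly (by omega) (by omega)
    refine ⟨P 0 0 + q, Submodule.add_mem _ hP0 hq, fun z hz => ?_⟩
    have h := hq' z hz
    rw [hnorm] at h
    simpa [sub_sub] using h

/-- A Bramble–Hilbert lemma on the square, in the maximum norm. -/
lemma IsJet.exists_abs_sub_le {n : ℕ} (hn : 2 ≤ n) {D : ℕ → ℕ → ℝ × ℝ → ℝ} (hD : IsJet n D) :
    ∃ q ∈ tensorPoly (n - 1), ∀ z ∈ Icc (-1 : ℝ) 1 ×ˢ Icc (-1 : ℝ) 1,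
      |D 0 0 z - q z| ≤ 4 ^ (n + 1) * jetNorm n D :=
  IsJet.exists_abs_sub_le_of_mean_zero hn n le_rfl D hD fun a b h1 h2 => by omega

/-- A linear functional on functions on `[−1,1]`, bounded in the maximum norm. -/
structure IsBddFun (N : (ℝ → ℝ) → ℝ) : Prop where
  congr : ∀ f g, EqOn f g (Icc (-1) 1) → N f = N g
  add : ∀ f g, Continuous f → Continuous g → N (fun s => f s + g s) = N f + N g
  smul : ∀ (c : ℝ) f, N (fun s => c * f s) = c * N f
  bound : ∀ f B, (∀ s ∈ Icc (-1 : ℝ) 1, |f s| ≤ B) → |N f| ≤ 2 * B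
  cont : ∀ v : ℝ × ℝ → ℝ, Continuous v → Continuous fun x => N fun y => v (x, y)

/-- The tensor product of two functionals. -/
def tens (M N : (ℝ → ℝ) → ℝ) (v : ℝ × ℝ → ℝ) : ℝ := M fun x => N fun y => v (x, y)

lemma tens_add {M N : (ℝ → ℝ) → ℝ} (hM : IsBddFun M) (hN : IsBddFun N) {u v : ℝ × ℝ → ℝ}
    (hu : Continuous u) (hv : Continuous v) :
    tens M N (fun z => u z + v z) = tens M N u + tens M N v := by
  unfold tens
  rw [← hM.add _ _ (hN.cont u hu) (hN.cont v hv)]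
  congr 1
  ext x
  exact hN.add _ _ (by fun_prop) (by fun_prop)

lemma tens_smul {M N : (ℝ → ℝ) → ℝ} (hM : IsBddFun M) (hN : IsBddFun N) (c : ℝ)
    (u : ℝ × ℝ → ℝ) : tens M N (fun z => c * u z) = c * tens M N u := by
  unfold tens
  simp only [hN.smul, hM.smul]

lemma tens_mul {M N : (ℝ → ℝ) → ℝ} (hM : IsBddFun M) (hN : IsBddFun N) (f g : ℝ → ℝ) :
    tens M N (fun z => f z.1 * g z.2) = M f * N g := by
  unfold tens
  simp only [hN.smul]
  rw [mul_comm, ← hM.smul]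
  simp only [mul_comm]

lemma abs_tens_le {M N : (ℝ → ℝ) → ℝ} (hM : IsBddFun M) (hN : IsBddFun N) {u : ℝ × ℝ → ℝ}
    {B : ℝ} (hB : ∀ z ∈ Icc (-1 : ℝ) 1 ×ˢ Icc (-1 : ℝ) 1, |u z| ≤ B) :
    |tens M N u| ≤ 4 * B := by
  have h := hM.bound (fun x => N fun y => u (x, y)) (2 * B) fun x hx =>
    hN.bound _ _ fun y hy => hB (x, y) ⟨hx, hy⟩
  unfold tens
  linarith

lemma tens_congr {M N : (ℝ → ℝ) → ℝ} (hM : IsBddFun M) (hN : IsBddFun N) {u v : ℝ × ℝ → ℝ}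
    (h : EqOn u v (Icc (-1 : ℝ) 1 ×ˢ Icc (-1 : ℝ) 1)) : tens M N u = tens M N v :=
  hM.congr _ _ fun _ hx => hN.congr _ _ fun _ hy => h ⟨hx, hy⟩

open Polynomial in
lemma exists_dual_basis {ι : Type*} [Fintype ι] {N : ι → (ℝ → ℝ) → ℝ}
    (hN : ∀ i, IsBddFun (N i)) (k : ℕ)
    (uni : ∀ f : ℝ[X], f.natDegree ≤ k → (∀ i, N i (fun s => f.eval s) = 0) → f = 0) :
    ∃ φ : ι → ℝ[X], ∀ a ≤ k, ∀ x : ℝ, ∑ i, N i (fun s => s ^ a) * (φ i).eval x = x ^ a := by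
  classical
  let T : degreeLT ℝ (k + 1) →ₗ[ℝ] (ι → ℝ) :=
    { toFun := fun f i => N i fun s => (f : ℝ[X]).eval s
      map_add' := fun f g => by
        ext i
        simp only [Submodule.coe_add, eval_add, Pi.add_apply]
        exact (hN i).add _ _ (by fun_prop) (by fun_prop)
      map_smul' := fun c f => by
        ext i
        simp only [Submodule.coe_smul, eval_smul, smul_eq_mul, Pi.smul_apply, RingHom.id_apply]
        exact (hN i).smul _ _ }
  have hT : LinearMap.ker T = ⊥ := by
    rw [LinearMap.ker_eq_bot']
    rintro ⟨f, hf⟩ h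
    have hdeg : f.natDegree ≤ k := by
      rw [mem_degreeLT] at hf
      exact natDegree_le_iff_degree_le.2 (Order.le_of_lt_succ (by exact_mod_cast hf))
    exact Subtype.ext (uni f hdeg fun i => congrFun h i)
  obtain ⟨G, hG⟩ := T.exists_leftInverse_of_injective hT
  refine ⟨fun i => (G (Pi.single i 1) : ℝ[X]), fun a ha x => ?_⟩
  have hX : (X ^ a : ℝ[X]) ∈ degreeLT ℝ (k + 1) := by
    rw [mem_degreeLT, degree_X_pow]
    exact_mod_cast Nat.lt_succ_of_le ha
  have h1 : G (T ⟨X ^ a, hX⟩) = ⟨X ^ a, hX⟩ := LinearMap.congr_fun hG _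
  rw [LinearMap.pi_apply_eq_sum_univ G] at h1
  have h2 := congrArg (fun f : degreeLT ℝ (k + 1) => (f : ℝ[X]).eval x) h1
  simp only [Submodule.coe_sum, Submodule.coe_smul, eval_finsetSum, eval_smul, smul_eq_mul,
    eval_pow, eval_X] at h2
  rw [← h2]
  refine Finset.sum_congr rfl fun i _ => ?_
  have e : (Pi.single i (1 : ℝ) : ι → ℝ) = fun j => if i = j then 1 else 0 := by
    ext j
    simp [Pi.single_apply, eq_comm]
  simp only [e]
  simp [T]

lemma sum_tens_mul_eq {ι : Type*} [Fintype ι] {N : ι → (ℝ → ℝ) → ℝ}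
    (hN : ∀ i, IsBddFun (N i)) {k : ℕ} {φ : ι → Polynomial ℝ}
    (hφ : ∀ a ≤ k, ∀ x : ℝ, ∑ i, N i (fun s => s ^ a) * (φ i).eval x = x ^ a)
    {Q : ℝ × ℝ → ℝ} (hQ : Q ∈ tensorPoly k) (x y : ℝ) :
    ∑ i, ∑ j, tens (N i) (N j) Q * ((φ i).eval x * (φ j).eval y) = Q (x, y) := by
  induction hQ using Submodule.span_induction with
  | mem f hf =>
    obtain ⟨a, ha, b, hb, rfl⟩ := hf
    simp only [tens_mul (hN _) (hN _) (fun s => s ^ a) (fun s => s ^ b)]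
    rw [← hφ a ha x, ← hφ b hb y, Finset.sum_mul_sum]
    exact Finset.sum_congr rfl fun i _ => Finset.sum_congr rfl fun j _ => by ring
  | zero =>
    have h : ∀ i j, tens (N i) (N j) 0 = 0 := fun i j => by
      have := tens_smul (hN i) (hN j) 0 0
      simp only [zero_mul] at this
      exact this
    simp [h]
  | add f g hf hg ihf ihg =>
    have h : ∀ i j, tens (N i) (N j) (f + g) = tens (N i) (N j) f + tens (N i) (N j) g :=
      fun i j => tens_add (hN i) (hN j) (continuous_of_mem_tensorPoly hf)
        (continuous_of_mem_tensorPoly hg)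
    simp only [h, add_mul, Finset.sum_add_distrib, ihf, ihg, Pi.add_apply]
  | smul c f _ ih =>
    have h : ∀ i j, tens (N i) (N j) (c • f) = c * tens (N i) (N j) f :=
      fun i j => tens_smul (hN i) (hN j) c f
    simp only [h, mul_assoc, ← Finset.mul_sum, ih, Pi.smul_apply, smul_eq_mul]

lemma exists_abs_eval_le (f : Polynomial ℝ) :
    ∃ K, 0 ≤ K ∧ ∀ x ∈ Icc (-1 : ℝ) 1, |f.eval x| ≤ K := by
  obtain ⟨K, hK⟩ := (isCompact_Icc (a := (-1 : ℝ)) (b := 1)).exists_bound_of_continuousOn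
    f.continuous.continuousOn
  exact ⟨K, (norm_nonneg _).trans (hK 0 (by norm_num)), hK⟩

/-- The polynomial interpolant of `u + b(y)` is bounded by `u` up to a function of `y`. -/
lemma exists_interpolant_bound {ι : Type*} [Fintype ι] {N : ι → (ℝ → ℝ) → ℝ}
    (hN : ∀ i, IsBddFun (N i)) {k : ℕ}
    (uni : ∀ f : Polynomial ℝ, f.natDegree ≤ k →
      (∀ i, N i (fun s => f.eval s) = 0) → f = 0) :
    ∃ C, 0 ≤ C ∧ ∀ Q ∈ tensorPoly k, ∀ u : ℝ × ℝ → ℝ, Continuous u → ∀ b : ℝ → ℝ, Continuous b →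
      ∀ B, (∀ z ∈ Icc (-1 : ℝ) 1 ×ˢ Icc (-1 : ℝ) 1, |u z| ≤ B) →
      (∀ i j, tens (N i) (N j) (fun z => Q z - (u z + b z.2)) = 0) →
      ∃ P A : ℝ × ℝ → ℝ, ∃ β : ℝ → ℝ, Continuous P ∧ Continuous β ∧
        (∀ x y, Q (x, y) = P (x, y) + β y) ∧
        (∀ x y, HasDerivAt (fun s => P (s, y)) (A (x, y)) x) ∧
        ∀ z ∈ Icc (-1 : ℝ) 1 ×ˢ Icc (-1 : ℝ) 1, |P z| ≤ C * B ∧ |A z| ≤ C * B := by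
  obtain ⟨φ, hφ⟩ := exists_dual_basis hN k uni
  choose K hK0 hK using fun i => exists_abs_eval_le (φ i)
  choose K' hK0' hK' using fun i => exists_abs_eval_le (φ i).derivative
  refine ⟨∑ i, ∑ j, 4 * ((K i + K' i) * K j),
    Finset.sum_nonneg fun i _ => Finset.sum_nonneg fun j _ =>
      mul_nonneg (by norm_num) (mul_nonneg (add_nonneg (hK0 i) (hK0' i)) (hK0 j)), ?_⟩
  intro Q hQ u hu b hb B hB h0
  have hB0 : 0 ≤ B := (abs_nonneg _).trans (hB (0, 0) (by norm_num))
  have hQu : ∀ i j, tens (N i) (N j) Q =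
      tens (N i) (N j) u + N i (fun s => s ^ 0) * N j b := by
    intro i j
    have hb' : Continuous fun z : ℝ × ℝ => z.1 ^ 0 * b z.2 := by fun_prop
    have hs : Continuous fun z => u z + z.1 ^ 0 * b z.2 := hu.add hb'
    have hr : Continuous fun z => Q z - (u z + b z.2) :=
      (continuous_of_mem_tensorPoly hQ).sub (by fun_prop)
    have e : Q = fun z => (fun z => u z + z.1 ^ 0 * b z.2) z + (Q z - (u z + b z.2)) := by
      ext z
      simp
    conv_lhs => rw [e]
    rw [tens_add (hN i) (hN j) hs hr, h0, add_zero, tens_add (hN i) (hN j) hu hb']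
    exact congrArg _ (tens_mul (hN i) (hN j) (fun s => s ^ 0) b)
  refine ⟨fun z => ∑ i, ∑ j, tens (N i) (N j) u * ((φ i).eval z.1 * (φ j).eval z.2),
    fun z => ∑ i, ∑ j, tens (N i) (N j) u * ((φ i).derivative.eval z.1 * (φ j).eval z.2),
    fun y => ∑ j, N j b * (φ j).eval y, by fun_prop, by fun_prop, fun x y => ?_,
    fun x y => ?_, fun z hz => ⟨?_, ?_⟩⟩
  · rw [← sum_tens_mul_eq hN hφ hQ x y]
    simp only [hQu, add_mul, Finset.sum_add_distrib]
    congr 1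
    have h1 := hφ 0 (Nat.zero_le _) x
    rw [pow_zero] at h1
    rw [← one_mul (∑ j, N j b * (φ j).eval y), ← h1, Finset.sum_mul_sum]
    exact Finset.sum_congr rfl fun i _ => Finset.sum_congr rfl fun j _ => by ring
  · exact HasDerivAt.fun_sum fun i _ => HasDerivAt.fun_sum fun j _ =>
      (((φ i).hasDerivAt x).mul_const ((φ j).eval y)).const_mul _
  all_goals
    rw [Finset.sum_mul]
    refine (Finset.abs_sum_le_sum_abs _ _).trans (Finset.sum_le_sum fun i _ => ?_)
    rw [Finset.sum_mul]
    refine (Finset.abs_sum_le_sum_abs _ _).trans (Finset.sum_le_sum fun j _ => ?_)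
    rw [abs_mul, abs_mul]
    have h1 := abs_tens_le (hN i) (hN j) hB
    have h2 := hK i z.1 hz.1
    have h3 := hK' i z.1 hz.1
    have h4 := hK j z.2 hz.2
    have h5 := hK0 i
    have h6 := hK0' i
    have h7 := hK0 j
  · calc _ ≤ 4 * B * ((K i + K' i) * K j) := by
          gcongr
          linarith
      _ = _ := by ring
  · calc _ ≤ 4 * B * ((K i + K' i) * K j) := by
          gcongr
          linarith
      _ = _ := by ring

lemma isBddFun_eval {t : ℝ} (ht : t ∈ Icc (-1 : ℝ) 1) : IsBddFun fun f => f t where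
  congr f g h := h ht
  add f g _ _ := rfl
  smul c f := rfl
  bound f B h := by
    have h1 := h t ht
    have h2 := abs_nonneg (f t)
    linarith
  cont v hv := by fun_prop

lemma isBddFun_moment (j : ℕ) : IsBddFun fun f => ∫ s in (-1 : ℝ)..1, f s * s ^ j where
  congr f g h := by
    refine intervalIntegral.integral_congr fun s hs => ?_
    rw [uIcc_of_le (by norm_num)] at hs
    simp only [h hs]
  add f g hf hg := by
    simp only [add_mul]
    exact intervalIntegral.integral_add (Continuous.intervalIntegrable (by fun_prop) _ _)
      (Continuous.intervalIntegrable (by fun_prop) _ _)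
  smul c f := by simp only [mul_assoc, intervalIntegral.integral_const_mul]
  bound f B h := by
    have h1 := intervalIntegral.norm_integral_le_of_norm_le_const (a := -1) (b := 1)
      (f := fun s => f s * s ^ j) (C := B) fun s hs => by
        rw [uIoc_of_le (by norm_num)] at hs
        have hs1 : |s| ≤ 1 := abs_le.2 ⟨hs.1.le, hs.2⟩
        rw [Real.norm_eq_abs, abs_mul, abs_pow]
        calc |f s| * |s| ^ j ≤ |f s| * 1 := by
              gcongr
              exact pow_le_one₀ (abs_nonneg _) hs1
          _ ≤ B := by rw [mul_one]; exact h s ⟨hs.1.le, hs.2⟩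
    rw [Real.norm_eq_abs] at h1
    norm_num at h1
    linarith
  cont v hv := continuous_integral_right (f := fun z => v z * z.2 ^ j) (by fun_prop)

/-- The one-dimensional vertex and moment functionals of the vertex-edge-cell interpolant. -/
noncomputable def vecFun {p : ℕ} : Bool ⊕ Fin p → (ℝ → ℝ) → ℝ
  | Sum.inl e, f => f (if e then 1 else -1)
  | Sum.inr j, f => ∫ s in (-1 : ℝ)..1, f s * s ^ (j : ℕ)

lemma isBddFun_vecFun {p : ℕ} (i : Bool ⊕ Fin p) : IsBddFun (vecFun i) := by
  match i with
  | Sum.inl e => exact isBddFun_eval (by cases e <;> norm_num)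
  | Sum.inr j => exact isBddFun_moment j

open Polynomial in
lemma eq_zero_of_vecFun_eq_zero {p : ℕ} (f : ℝ[X]) (hf : f.natDegree ≤ p + 1)
    (h : ∀ i : Bool ⊕ Fin p, vecFun i (fun s => f.eval s) = 0) : f = 0 := by
  have h1 : X - C 1 ∣ f := dvd_iff_isRoot.2 (by simpa [vecFun] using h (Sum.inl true))
  have h2 : X - C (-1) ∣ f := dvd_iff_isRoot.2 (by simpa [vecFun] using h (Sum.inl false))
  have hc : IsCoprime (X - C (1 : ℝ)) (X - C (-1)) :=
    isCoprime_X_sub_C_of_isUnit_sub (by norm_num)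
  obtain ⟨r, hr⟩ := hc.mul_dvd h1 h2
  by_contra hf0
  have hr0 : r ≠ 0 := by
    rintro rfl
    exact hf0 (by rw [hr, mul_zero])
  have hdeg : r.natDegree < p := by
    have h3 : f.natDegree = 1 + 1 + r.natDegree := by
      rw [hr, natDegree_mul (mul_ne_zero (X_sub_C_ne_zero _) (X_sub_C_ne_zero _)) hr0,
        natDegree_mul (X_sub_C_ne_zero _) (X_sub_C_ne_zero _), natDegree_X_sub_C,
        natDegree_X_sub_C]
    omega
  have hint : ∫ s in (-1 : ℝ)..1, f.eval s * r.eval s = 0 := by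
    have e : ∀ s, f.eval s * r.eval s =
        ∑ j : Fin p, r.coeff j * (f.eval s * s ^ (j : ℕ)) := by
      intro s
      rw [eval_eq_sum_range' hdeg, Finset.mul_sum, ← Fin.sum_univ_eq_sum_range
        (fun j => f.eval s * (r.coeff j * s ^ j))]
      exact Finset.sum_congr rfl fun j _ => by ring
    simp only [e]
    rw [intervalIntegral.integral_finsetSum fun j _ =>
      Continuous.intervalIntegrable (by fun_prop) _ _]
    refine Finset.sum_eq_zero fun j _ => ?_
    rw [intervalIntegral.integral_const_mul]
    have := h (Sum.inr j)
    simp only [vecFun] at this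
    rw [this, mul_zero]
  have hex : ∃ c ∈ Ioo (-1 : ℝ) 1, r.eval c ≠ 0 := by
    by_contra! hall
    exact hr0 (eq_zero_of_infinite_isRoot r
      ((Ioo_infinite (by norm_num : (-1 : ℝ) < 1)).mono fun c hc => hall c hc))
  obtain ⟨c, hc, hrc⟩ := hex
  have hpos : 0 < ∫ s in (-1 : ℝ)..1, (1 - s ^ 2) * r.eval s ^ 2 := by
    refine intervalIntegral.integral_pos (by norm_num) (by fun_prop) (fun s hs => ?_)
      ⟨c, ⟨hc.1.le, hc.2.le⟩, ?_⟩
    · exact mul_nonneg (by nlinarith [hs.1, hs.2]) (sq_nonneg _)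
    · exact mul_pos (by nlinarith [hc.1, hc.2]) (by positivity)
  have hneg : ∫ s in (-1 : ℝ)..1, f.eval s * r.eval s =
      -∫ s in (-1 : ℝ)..1, (1 - s ^ 2) * r.eval s ^ 2 := by
    rw [← intervalIntegral.integral_neg]
    congr 1
    ext s
    rw [hr]
    simp
    ring
  linarith

lemma ev_mem_tensorPoly {k : ℕ} {q : MvPolynomial (Fin 2) ℝ} (hq : memQ k q) :
    ev q ∈ tensorPoly k := by
  have e : ev q = ∑ d ∈ q.support, q.coeff d • fun z : ℝ × ℝ => z.1 ^ d 0 * z.2 ^ d 1 := by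
    ext z
    simp [ev, MvPolynomial.eval_eq', Fin.prod_univ_two]
  rw [e]
  exact Submodule.sum_mem _ fun d hd => Submodule.smul_mem _ _ (monomial_mem_tensorPoly
    ((MvPolynomial.monomial_le_degreeOf 0 hd).trans hq.1)
    ((MvPolynomial.monomial_le_degreeOf 1 hd).trans hq.2))

lemma IsVEC.tens_eq_zero {p : ℕ} {v : ℝ × ℝ → ℝ} {q : MvPolynomial (Fin 2) ℝ}
    (h : IsVEC (p + 1) v q) (i j : Bool ⊕ Fin p) :
    tens (vecFun i) (vecFun j) (fun z => ev q z - v z) = 0 := by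
  obtain ⟨-, hv, hx, hy, hc⟩ := h
  have hmem : ∀ e : Bool, (if e then (1 : ℝ) else -1) ∈ ({-1, 1} : Set ℝ) := by
    intro e
    cases e <;> simp
  have hdeg : ∀ j : Fin p, (Polynomial.X ^ (j : ℕ) : Polynomial ℝ).natDegree ≤ p + 1 - 2 := by
    intro j
    rw [Polynomial.natDegree_X_pow]
    omega
  match i, j with
  | Sum.inl a, Sum.inl b => exact sub_eq_zero.2 (hv _ (hmem a) _ (hmem b))
  | Sum.inl a, Sum.inr j => simpa [tens, vecFun] using hy _ (hmem a) _ (hdeg j)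
  | Sum.inr i, Sum.inl b => simpa [tens, vecFun] using hx _ (hmem b) _ (hdeg i)
  | Sum.inr i, Sum.inr j =>
    have hr : memQ (p + 1 - 2)
        (MvPolynomial.X 0 ^ (i : ℕ) * MvPolynomial.X 1 ^ (j : ℕ) : MvPolynomial (Fin 2) ℝ) := by
      constructor
      all_goals
        refine (MvPolynomial.degreeOf_mul_le _ _ _).trans ((add_le_add
          (MvPolynomial.degreeOf_pow_le _ _ _) (MvPolynomial.degreeOf_pow_le _ _ _)).trans ?_)
        simp [MvPolynomial.degreeOf_X]
        omega
    have := hc _ hr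
    simp only [tens, vecFun, ← intervalIntegral.integral_mul_const]
    refine Eq.trans ?_ this
    congr 1
    ext x
    congr 1
    ext y
    simp [ev]
    ring

lemma IsGLNodes.mem_Icc {p : ℕ} {t : Fin (p + 1) → ℝ} (h : IsGLNodes p t) (i : Fin (p + 1)) :
    t i ∈ Icc (-1 : ℝ) 1 :=
  ⟨h.2.1 ▸ h.1.monotone (Fin.zero_le i), h.2.2.1 ▸ h.1.monotone (Fin.le_last i)⟩

open Polynomial in
lemma derivative_legendre_ne_zero {p : ℕ} (hp : 1 ≤ p) : derivative (legendre p) ≠ 0 := by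
  intro h
  have hm : ((X ^ 2 - 1 : ℝ[X]) ^ p).coeff (2 * p) = 1 := by
    have h1 : (X ^ 2 - 1 : ℝ[X]).Monic := by
      have := monic_X_pow_sub_C (1 : ℝ) two_ne_zero
      simpa using this
    have h2 : (X ^ 2 - 1 : ℝ[X]).natDegree = 2 := by
      have := natDegree_X_pow_sub_C (n := 2) (r := (1 : ℝ))
      simpa using this
    have h3 := (h1.pow p).coeff_natDegree
    rwa [h1.natDegree_pow, h2, mul_comm] at h3
  rw [legendre, derivative_C_mul, ← Function.iterate_succ_apply' (f := derivative)] at h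
  have h1 := congrArg (fun f : ℝ[X] => f.coeff (p - 1)) h
  simp only [coeff_C_mul, coeff_iterate_derivative, coeff_zero] at h1
  rw [show p - 1 + p.succ = 2 * p by omega, hm] at h1
  have h2 : 0 < (2 * p).descFactorial p.succ := Nat.descFactorial_pos.2 (by omega)
  have h3 : (0 : ℝ) < (2 * p).descFactorial p.succ := by exact_mod_cast h2
  have h4 : (0 : ℝ) < 1 / (2 ^ p * (p.factorial : ℝ)) := by positivity
  rw [nsmul_eq_mul, mul_one] at h1
  exact (mul_pos h4 h3).ne' h1

open Polynomial in
/-- The Gauß–Lobatto nodes are uniquely determined. -/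
lemma IsGLNodes.unique {p : ℕ} (hp : 1 ≤ p) {s t : Fin (p + 1) → ℝ} (hs : IsGLNodes p s)
    (ht : IsGLNodes p t) : s = t := by
  classical
  set G : ℝ[X] := (1 - X ^ 2) * derivative (legendre p) with hG
  have hG0 : G ≠ 0 := by
    refine mul_ne_zero (fun h => ?_) (derivative_legendre_ne_zero hp)
    have := congrArg (eval 0) h
    simp at this
  have hdeg : G.natDegree ≤ p + 1 := by
    have h1 : (X ^ 2 - 1 : ℝ[X]).natDegree ≤ 2 := by compute_degree
    have h2 : (1 - X ^ 2 : ℝ[X]).natDegree ≤ 2 := by compute_degree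
    have h3 : (legendre p).natDegree ≤ 2 * p - p := by
      refine (natDegree_C_mul_le _ _).trans ((natDegree_iterate_derivative _ _).trans ?_)
      have := natDegree_pow_le_of_le p h1
      omega
    have h4 := natDegree_derivative_le (legendre p)
    refine natDegree_mul_le.trans ?_
    omega
  have key : ∀ u, IsGLNodes p u → Finset.univ.image u = G.roots.toFinset := by
    intro u hu
    refine Finset.eq_of_subset_of_card_le (fun x hx => ?_) ?_
    · obtain ⟨i, -, rfl⟩ := Finset.mem_image.1 hx
      rw [Multiset.mem_toFinset, mem_roots hG0, IsRoot.def, hG, eval_mul]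
      simpa using hu.2.2.2 i
    · rw [Finset.card_image_of_injective _ hu.1.injective, Finset.card_univ, Fintype.card_fin]
      exact (Multiset.toFinset_card_le _).trans ((card_roots' G).trans hdeg)
  refine (hs.1.range_inj ht.1).1 ?_
  have := (key s hs).trans (key t ht).symm
  simpa using congrArg (fun A : Finset ℝ => (A : Set ℝ)) this

lemma exists_nodal_interpolant_bound {p : ℕ} {t : Fin (p + 1) → ℝ} (ht : IsGLNodes p t) :
    ∃ C, 0 ≤ C ∧ ∀ Q ∈ tensorPoly p, ∀ u : ℝ × ℝ → ℝ, Continuous u → ∀ b : ℝ → ℝ, Continuous b →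
      ∀ B, (∀ z ∈ Icc (-1 : ℝ) 1 ×ˢ Icc (-1 : ℝ) 1, |u z| ≤ B) →
      (∀ i j, Q (t i, t j) - (u (t i, t j) + b (t j)) = 0) →
      ∃ P A : ℝ × ℝ → ℝ, ∃ β : ℝ → ℝ, Continuous P ∧ Continuous β ∧
        (∀ x y, Q (x, y) = P (x, y) + β y) ∧
        (∀ x y, HasDerivAt (fun s => P (s, y)) (A (x, y)) x) ∧
        ∀ z ∈ Icc (-1 : ℝ) 1 ×ˢ Icc (-1 : ℝ) 1, |P z| ≤ C * B ∧ |A z| ≤ C * B :=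
  exists_interpolant_bound (N := fun i f => f (t i)) (fun i => isBddFun_eval (ht.mem_Icc i))
    fun f hf h => Polynomial.eq_zero_of_natDegree_lt_card_of_eval_eq_zero f ht.1.injective h
      (by rw [Fintype.card_fin]; omega)

/-- The pointwise estimate on the reference square. -/
lemma exists_reference_bound {p m : ℕ} (hp : 1 ≤ p) (hm1 : 1 ≤ m) (hm2 : m ≤ p) :
    ∃ C : ℝ, 0 < C ∧ ∀ t : Fin (p + 1) → ℝ, IsGLNodes p t →
      ∀ D : ℕ → ℕ → ℝ × ℝ → ℝ, IsJet (m + 2) D →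
      ∀ v : ℝ × ℝ → ℝ, EqOn v (D 0 0) (Icc (-1 : ℝ) 1 ×ˢ Icc (-1 : ℝ) 1) →
      ∀ qP qd : MvPolynomial (Fin 2) ℝ, IsVEC (p + 1) v qP →
        IsLag p t (fun z => ev qP z - v z) qd →
      ∀ x ∈ Icc (-1 : ℝ) 1, ∀ y ∈ Icc (-1 : ℝ) 1, ∃ d,
        HasDerivAt (fun s => ev qd (s, y) - ev qP (s, y)) d x ∧
        |d + D 1 0 (x, y)| ≤ C * jetNorm (m + 1) fun a b => D (a + 1) b := by
  by_cases hex : ∃ t, IsGLNodes p t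
  swap
  · exact ⟨1, one_pos, fun t ht => absurd ⟨t, ht⟩ hex⟩
  obtain ⟨t, ht⟩ := hex
  obtain ⟨C₁, hC₁, H₁⟩ := exists_interpolant_bound (k := p + 1)
    (isBddFun_vecFun (p := p)) eq_zero_of_vecFun_eq_zero
  obtain ⟨C₂, hC₂, H₂⟩ := exists_nodal_interpolant_bound ht
  refine ⟨(C₂ * ((C₁ + 1) * 2) + C₁ * 2 + 1) * 4 ^ (m + 1 + 1), by positivity, ?_⟩
  intro t' ht' D hD v hv qP qd hP hd x hx y hy
  obtain rfl := ht'.unique hp ht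
  obtain ⟨q, hq, hqb⟩ := (hD.shift (n := m + 1)).exists_abs_sub_le (by omega)
  set M : ℝ := 4 ^ (m + 1 + 1) * jetNorm (m + 1) fun a b => D (a + 1) b with hM
  obtain ⟨V, hV, hV'⟩ := exists_antideriv_tensorPoly hq
  have hVp : V ∈ tensorPoly (p + 1) := tensorPoly_mono (by omega) hV
  have cV := continuous_of_mem_tensorPoly hV
  have cq := continuous_of_mem_tensorPoly hq
  have cD := hD.cont 0 0 (by omega)
  have cD1 := hD.cont 1 0 (by omega)
  set b : ℝ → ℝ := fun y => D 0 0 (-1, y) - V (-1, y) with hb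
  set u : ℝ × ℝ → ℝ := fun z => D 0 0 z - V z - b z.2 with hu
  have cb : Continuous b := by fun_prop
  have cu : Continuous u := by fun_prop
  have hub : ∀ z ∈ Icc (-1 : ℝ) 1 ×ˢ Icc (-1 : ℝ) 1, |u z| ≤ 2 * M := by
    rintro ⟨x, y⟩ ⟨hx, hy⟩
    refine (abs_sub_le_integral_abs_deriv (f := fun s => D 0 0 (s, y) - V (s, y))
      (f' := fun s => D 1 0 (s, y) - q (s, y)) (by fun_prop) (by fun_prop)
      (fun s hs => (hD.dx 0 0 (by omega) s hs y hy).sub (hV' s y)) hx (x' := -1)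
      (by norm_num)).trans ?_
    have h := intervalIntegral.integral_mono_on (a := -1) (b := 1)
      (f := fun s => |D 1 0 (s, y) - q (s, y)|) (g := fun _ => M) (μ := volume) (by norm_num)
      (Continuous.intervalIntegrable (by fun_prop) _ _) (by simp)
      fun s hs => hqb (s, y) ⟨hs, hy⟩
    rw [intervalIntegral.integral_const, smul_eq_mul] at h
    linarith
  obtain ⟨P, A, β, cP, cβ, hPQ, hPA, hPb⟩ := H₁ (ev qP - V)
    (Submodule.sub_mem _ (ev_mem_tensorPoly hP.1) hVp) u cu b cb (2 * M) hub (by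
      intro i j
      rw [← hP.tens_eq_zero i j]
      refine tens_congr (isBddFun_vecFun i) (isBddFun_vecFun j) fun z hz => ?_
      simp only [hu, Pi.sub_apply, hv hz]
      ring)
  obtain ⟨P', A', β', -, -, hPQ', hPA', hPb'⟩ := H₂ (ev qd) (ev_mem_tensorPoly hd.1)
    (fun z => P z - u z) (by fun_prop) (fun y => β y - b y) (by fun_prop) ((C₁ + 1) * (2 * M))
    (fun z hz => (abs_sub _ _).trans (by linarith [(hPb z hz).1, hub z hz])) (by
      intro i j
      have h1 := hPQ (t' i) (t' j)
      have h2 := hv (show (t' i, t' j) ∈ Icc (-1 : ℝ) 1 ×ˢ Icc (-1 : ℝ) 1 from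
        ⟨ht'.mem_Icc i, ht'.mem_Icc j⟩)
      rw [hd.2 i j]
      simp only [hu, Pi.sub_apply, h2] at h1 ⊢
      linarith)
  have hxy : (x, y) ∈ Icc (-1 : ℝ) 1 ×ˢ Icc (-1 : ℝ) 1 := ⟨hx, hy⟩
  refine ⟨A' (x, y) - (A (x, y) + q (x, y)), ?_, ?_⟩
  · have h := ((hPA' x y).add_const (β' y)).sub (((hPA x y).add_const (β y)).add (hV' x y))
    refine h.congr_of_eventuallyEq (Filter.Eventually.of_forall fun s => ?_)
    have h1 := hPQ s y
    have h2 := hPQ' s y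
    simp only [Pi.sub_apply, Pi.add_apply] at h1 h2 ⊢
    linarith
  · have h1 := abs_le.1 (hPb' _ hxy).2
    have h2 := abs_le.1 (hPb _ hxy).2
    have h3 := abs_le.1 (hqb _ hxy)
    simp only [zero_add] at h3
    rw [mul_assoc, ← hM, abs_le]
    constructor <;> linarith

lemma hasDerivAt_fst_slice {f : ℝ × ℝ → ℝ} {z : ℝ × ℝ} (hf : DifferentiableAt ℝ f z) :
    HasDerivAt (fun s => f (s, z.2)) (fderiv ℝ f z (1, 0)) z.1 :=
  hf.hasFDerivAt.comp_hasDerivAt (f := fun s : ℝ => (s, z.2)) z.1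
    ((hasDerivAt_id _).prodMk (hasDerivAt_const _ _))

lemma hasDerivAt_snd_slice {f : ℝ × ℝ → ℝ} {z : ℝ × ℝ} (hf : DifferentiableAt ℝ f z) :
    HasDerivAt (fun s => f (z.1, s)) (fderiv ℝ f z (0, 1)) z.2 :=
  hf.hasFDerivAt.comp_hasDerivAt (f := fun s : ℝ => (z.1, s)) z.2
    ((hasDerivAt_const _ _).prodMk (hasDerivAt_id _))

lemma pdx_eq_fderiv {f : ℝ × ℝ → ℝ} {z : ℝ × ℝ} (hf : DifferentiableAt ℝ f z) :
    pdx f z = fderiv ℝ f z (1, 0) :=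
  (hasDerivAt_fst_slice hf).deriv

lemma pdy_eq_fderiv {f : ℝ × ℝ → ℝ} {z : ℝ × ℝ} (hf : DifferentiableAt ℝ f z) :
    pdy f z = fderiv ℝ f z (0, 1) :=
  (hasDerivAt_snd_slice hf).deriv

lemma contDiffOn_pdx {U : Set (ℝ × ℝ)} (hU : IsOpen U) {n : ℕ} {f : ℝ × ℝ → ℝ}
    (hf : ContDiffOn ℝ (n + 1 : ℕ) f U) : ContDiffOn ℝ n (pdx f) U :=
  ((hf.fderiv_of_isOpen hU (m := n) (by norm_cast)).clm_apply contDiffOn_const).congr fun _ hz =>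
    pdx_eq_fderiv ((hf.contDiffAt (hU.mem_nhds hz)).differentiableAt (by simp))

lemma contDiffOn_pdy {U : Set (ℝ × ℝ)} (hU : IsOpen U) {n : ℕ} {f : ℝ × ℝ → ℝ}
    (hf : ContDiffOn ℝ (n + 1 : ℕ) f U) : ContDiffOn ℝ n (pdy f) U :=
  ((hf.fderiv_of_isOpen hU (m := n) (by norm_cast)).clm_apply contDiffOn_const).congr fun _ hz =>
    pdy_eq_fderiv ((hf.contDiffAt (hU.mem_nhds hz)).differentiableAt (by simp))

lemma eqOn_pdx {U : Set (ℝ × ℝ)} (hU : IsOpen U) {f g : ℝ × ℝ → ℝ} (h : EqOn f g U) :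
    EqOn (pdx f) (pdx g) U := fun z hz => by
  refine Filter.EventuallyEq.deriv_eq ?_
  have : Continuous fun s : ℝ => (s, z.2) := by fun_prop
  filter_upwards [(hU.preimage this).mem_nhds (x := z.1) hz] with s hs using h hs

/-- Partial derivatives of a `C²` function commute. -/
lemma pdy_pdx_eq {U : Set (ℝ × ℝ)} (hU : IsOpen U) {f : ℝ × ℝ → ℝ}
    (hf : ContDiffOn ℝ 2 f U) : EqOn (pdy (pdx f)) (pdx (pdy f)) U := by
  intro z hz
  have hd : ∀ z ∈ U, DifferentiableAt ℝ f z := fun z hz =>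
    (hf.contDiffAt (hU.mem_nhds hz)).differentiableAt (by simp)
  have h2 := hf.contDiffAt (hU.mem_nhds hz)
  have hd2 : DifferentiableAt ℝ (fderiv ℝ f) z :=
    (h2.fderiv_right (m := 1) (by norm_num)).differentiableAt (by simp)
  have e : ∀ v : ℝ × ℝ, HasFDerivAt (fun z => fderiv ℝ f z v)
      ((ContinuousLinearMap.apply ℝ ℝ v).comp (fderiv ℝ (fderiv ℝ f) z)) z := fun v =>
    (ContinuousLinearMap.apply ℝ ℝ v).hasFDerivAt.comp z hd2.hasFDerivAt
  have hx : HasFDerivAt (pdx f) _ z := (e (1, 0)).congr_of_eventuallyEq (by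
    filter_upwards [hU.mem_nhds hz] with y hy using pdx_eq_fderiv (hd y hy))
  have hy : HasFDerivAt (pdy f) _ z := (e (0, 1)).congr_of_eventuallyEq (by
    filter_upwards [hU.mem_nhds hz] with y hy using pdy_eq_fderiv (hd y hy))
  rw [pdy_eq_fderiv hx.differentiableAt, pdx_eq_fderiv hy.differentiableAt, hx.fderiv, hy.fderiv]
  exact (h2.isSymmSndFDerivAt (by simp)) (0, 1) (1, 0)

lemma contDiffOn_iterate {U : Set (ℝ × ℝ)} (hU : IsOpen U) {n : ℕ} (a b : ℕ) {f : ℝ × ℝ → ℝ}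
    (hf : ContDiffOn ℝ (n + a + b : ℕ) f U) : ContDiffOn ℝ n (pdx^[a] (pdy^[b] f)) U := by
  induction a generalizing n with
  | zero =>
    induction b generalizing n with
    | zero => exact hf
    | succ b ih =>
      simp only [Function.iterate_succ_apply', Function.iterate_zero, id] at ih ⊢
      exact contDiffOn_pdy hU (ih (by convert hf using 2; ring))
  | succ a ih =>
    rw [Function.iterate_succ_apply']
    exact contDiffOn_pdx hU (ih (by convert hf using 2; ring))

lemma pdy_iterate {U : Set (ℝ × ℝ)} (hU : IsOpen U) (a b : ℕ) {f : ℝ × ℝ → ℝ}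
    (hf : ContDiffOn ℝ (a + b + 1 : ℕ) f U) :
    EqOn (pdy (pdx^[a] (pdy^[b] f))) (pdx^[a] (pdy^[b + 1] f)) U := by
  induction a with
  | zero =>
    rw [Function.iterate_succ_apply' pdy]
    exact fun _ _ => rfl
  | succ a ih =>
    rw [Function.iterate_succ_apply', Function.iterate_succ_apply']
    refine (pdy_pdx_eq hU ?_).trans (eqOn_pdx hU (ih (hf.of_le ?_)))
    · exact contDiffOn_iterate hU (n := 2) a b (by convert hf using 2; ring)
    · norm_cast; omega

/-- The partial derivatives of `w ∘ F_τ`, extended constantly outside the reference square. -/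
noncomputable def pullbackJet (x0 y0 h k : ℝ) (w : ℝ × ℝ → ℝ) (a b : ℕ) (z : ℝ × ℝ) : ℝ :=
  (h / 2) ^ a * (k / 2) ^ b * pdx^[a] (pdy^[b] w)
    (Fmap x0 y0 h k (max (-1) (min z.1 1), max (-1) (min z.2 1)))

lemma max_min_eq_self {s : ℝ} (hs : s ∈ Icc (-1 : ℝ) 1) : max (-1) (min s 1) = s := by
  rw [min_eq_left hs.2, max_eq_right hs.1]

lemma Fmap_mem {x0 y0 h k : ℝ} (hh : 0 < h) (hk : 0 < k) {z : ℝ × ℝ}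
    (hz : z ∈ Icc (-1 : ℝ) 1 ×ˢ Icc (-1 : ℝ) 1) :
    Fmap x0 y0 h k z ∈ Icc (x0, y0) (x0 + h, y0 + k) := by
  obtain ⟨⟨h1, h2⟩, h3, h4⟩ := hz
  refine ⟨⟨?_, ?_⟩, ?_, ?_⟩ <;> simp only [Fmap] <;> nlinarith

lemma Fmap_clamp_mem {x0 y0 h k : ℝ} (hh : 0 < h) (hk : 0 < k) (z : ℝ × ℝ) :
    Fmap x0 y0 h k (max (-1) (min z.1 1), max (-1) (min z.2 1)) ∈
      Icc (x0, y0) (x0 + h, y0 + k) :=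
  Fmap_mem hh hk (by constructor <;> simp)

lemma Finv_mem {x0 y0 h k : ℝ} (hh : 0 < h) (hk : 0 < k) {z : ℝ × ℝ}
    (hz : z ∈ Icc (x0, y0) (x0 + h, y0 + k)) :
    Finv x0 y0 h k z ∈ Icc (-1 : ℝ) 1 ×ˢ Icc (-1 : ℝ) 1 := by
  obtain ⟨⟨h1, h2⟩, h3, h4⟩ := hz
  simp only at h1 h2 h3 h4
  have e : ∀ a b : ℝ, 0 < b → 0 ≤ a → a ≤ b → 2 * a / b - 1 ∈ Icc (-1 : ℝ) 1 := by
    intro a b hb ha hab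
    have h5 : 0 ≤ a / b := by positivity
    have h6 : a / b ≤ 1 := by rwa [div_le_one hb]
    rw [mul_div_assoc]
    constructor <;> linarith
  exact ⟨e _ _ hh (by linarith) (by linarith), e _ _ hk (by linarith) (by linarith)⟩

lemma Fmap_Finv {x0 y0 h k : ℝ} (hh : 0 < h) (hk : 0 < k) (z : ℝ × ℝ) :
    Fmap x0 y0 h k (Finv x0 y0 h k z) = z := by
  ext <;> simp only [Fmap, Finv] <;> field_simp <;> ring

lemma pullbackJet_eq {x0 y0 h k : ℝ} (w : ℝ × ℝ → ℝ) (a b : ℕ) {z : ℝ × ℝ}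
    (hz : z ∈ Icc (-1 : ℝ) 1 ×ˢ Icc (-1 : ℝ) 1) :
    pullbackJet x0 y0 h k w a b z =
      (h / 2) ^ a * (k / 2) ^ b * pdx^[a] (pdy^[b] w) (Fmap x0 y0 h k z) := by
  rw [pullbackJet, max_min_eq_self hz.1, max_min_eq_self hz.2]

lemma isJet_pullbackJet {x0 y0 h k : ℝ} (hh : 0 < h) (hk : 0 < k) {U : Set (ℝ × ℝ)} (hU : IsOpen U)
    (hτ : Icc (x0, y0) (x0 + h, y0 + k) ⊆ U) {n : ℕ} {w : ℝ × ℝ → ℝ} (hw : ContDiffOn ℝ n w U) :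
    IsJet n (pullbackJet x0 y0 h k w) where
  cont a b hab := by
    have hc : ContinuousOn (pdx^[a] (pdy^[b] w)) U :=
      (contDiffOn_iterate hU (n := 0) a b
        (hw.of_le (by norm_cast; omega))).continuousOn
    refine continuous_const.mul (hc.comp_continuous ?_ fun z => hτ (Fmap_clamp_mem hh hk z))
    unfold Fmap
    fun_prop
  dx a b hab x hx y hy := by
    have hF := hτ (Fmap_mem (x0 := x0) (y0 := y0) hh hk (z := (x, y)) ⟨Ioo_subset_Icc_self hx, hy⟩)
    have hd : DifferentiableAt ℝ (pdx^[a] (pdy^[b] w)) (Fmap x0 y0 h k (x, y)) :=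
      ((contDiffOn_iterate hU (n := 1) a b
        (hw.of_le (by norm_cast; omega))).contDiffAt (hU.mem_nhds hF)).differentiableAt (by simp)
    have h1 := hasDerivAt_fst_slice hd
    have h2 : HasDerivAt (fun s => (Fmap x0 y0 h k (s, y)).1) (h / 2) x := by
      simp only [Fmap]
      exact (((((hasDerivAt_id' x).add_const 1).const_mul h).div_const 2).const_add x0).congr_deriv
        (by ring)
    have h3 := (h1.comp x h2).const_mul ((h / 2) ^ a * (k / 2) ^ b)
    rw [pullbackJet_eq _ _ _ ⟨Ioo_subset_Icc_self hx, hy⟩, Function.iterate_succ_apply',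
      pdx_eq_fderiv hd]
    refine (h3.congr_of_eventuallyEq ?_).congr_deriv (by ring)
    filter_upwards [Ioo_mem_nhds hx.1 hx.2] with s hs
    rw [pullbackJet_eq _ _ _ ⟨Ioo_subset_Icc_self hs, hy⟩]
    rfl
  dy a b hab x hx y hy := by
    have hF := hτ (Fmap_mem (x0 := x0) (y0 := y0) hh hk (z := (x, y)) ⟨hx, Ioo_subset_Icc_self hy⟩)
    have hd : DifferentiableAt ℝ (pdx^[a] (pdy^[b] w)) (Fmap x0 y0 h k (x, y)) :=
      ((contDiffOn_iterate hU (n := 1) a b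
        (hw.of_le (by norm_cast; omega))).contDiffAt (hU.mem_nhds hF)).differentiableAt (by simp)
    have h1 := hasDerivAt_snd_slice hd
    have h2 : HasDerivAt (fun s => (Fmap x0 y0 h k (x, s)).2) (k / 2) y := by
      simp only [Fmap]
      exact (((((hasDerivAt_id' y).add_const 1).const_mul k).div_const 2).const_add y0).congr_deriv
        (by ring)
    have h3 := (h1.comp y h2).const_mul ((h / 2) ^ a * (k / 2) ^ b)
    rw [pullbackJet_eq _ _ _ ⟨hx, Ioo_subset_Icc_self hy⟩,
      ← pdy_iterate hU a b (hw.of_le (by norm_cast)) hF, pdy_eq_fderiv hd]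
    refine (h3.congr_of_eventuallyEq ?_).congr_deriv (by ring)
    filter_upwards [Ioo_mem_nhds hy.1 hy.2] with s hs
    rw [pullbackJet_eq _ _ _ ⟨hx, Ioo_subset_Icc_self hs⟩]
    rfl

lemma sqInt_comp_Fmap {x0 y0 h k : ℝ} (hh : 0 < h) (hk : 0 < k) {g : ℝ × ℝ → ℝ}
    (hg : IntegrableOn g (Icc (x0, y0) (x0 + h, y0 + k))) :
    sqInt (fun z => g (Fmap x0 y0 h k z)) =
      4 / (h * k) * ∫ z in Icc (x0, y0) (x0 + h, y0 + k), g z := by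
  have e : ∀ (c d : ℝ) (f : ℝ → ℝ), 0 < c →
      ∫ s in (-1 : ℝ)..1, f (d + c * (s + 1) / 2) = 2 / c * ∫ s in Icc d (d + c), f s := by
    intro c d f hc
    have := intervalIntegral.integral_comp_mul_add (a := -1) (b := 1) f (c := c / 2)
      (by positivity) (d + c / 2)
    rw [integral_Icc_eq_integral_Ioc, ← intervalIntegral.integral_of_le (by linarith)]
    convert this using 2
    · ext s; congr 1; ring
    · rw [smul_eq_mul, inv_div]
      congr 2 <;> ring
  rw [← Icc_prod_Icc] at hg ⊢
  rw [Measure.volume_eq_prod] at hg ⊢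
  rw [setIntegral_prod g hg, sqInt]
  simp only [Fmap]
  rw [e h x0 (fun x => ∫ y in (-1 : ℝ)..1, g (x, y0 + k * (y + 1) / 2)) hh]
  simp only [fun x => e k y0 (fun y => g (x, y)) hk, integral_const_mul]
  field_simp
  ring

/-- The Cauchy–Schwarz inequality on the reference square. -/
lemma sqInt_abs_le_sqrt {f : ℝ × ℝ → ℝ} (hf : Continuous f) :
    sqInt (fun z => |f z|) ≤ 2 * √(sqInt fun z => f z ^ 2) := by
  set S := sqInt fun z => |f z|
  have h0 : 0 ≤ sqInt fun z => (f z ^ 2 + -(S / 2) * |f z|) + (S / 4) ^ 2 := by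
    have := sqInt_abs_nonneg (f := fun z => (|f z| - S / 4) ^ 2)
    convert this using 2
    ext z
    rw [abs_of_nonneg (sq_nonneg (|f z| - S / 4)), sub_sq, sq_abs]
    ring
  rw [sqInt_add (by fun_prop) (by fun_prop), sqInt_add (by fun_prop) (by fun_prop),
    sqInt_const_mul, sqInt_const] at h0
  change 0 ≤ _ + -(S / 2) * S + _ at h0
  have h1 : S / 2 ≤ √(sqInt fun z => f z ^ 2) := Real.le_sqrt_of_sq_le (by nlinarith)
  linarith

lemma sqInt_congr {f g : ℝ × ℝ → ℝ} (h : EqOn f g (Icc (-1 : ℝ) 1 ×ˢ Icc (-1 : ℝ) 1)) :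
    sqInt f = sqInt g := by
  refine intervalIntegral.integral_congr fun x hx => intervalIntegral.integral_congr fun y hy => ?_
  rw [uIcc_of_le (by norm_num)] at hx hy
  exact h ⟨hx, hy⟩

lemma sqInt_abs_pullbackJet_le {x0 y0 h k : ℝ} (hh : 0 < h) (hk : 0 < k) {U : Set (ℝ × ℝ)}
    (hU : IsOpen U) (hτ : Icc (x0, y0) (x0 + h, y0 + k) ⊆ U) {n : ℕ} {w : ℝ × ℝ → ℝ}
    (hw : ContDiffOn ℝ n w U) {a b : ℕ} (hab : a + b ≤ n) :
    sqInt (fun z => |pullbackJet x0 y0 h k w a b z|) ≤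
      2 * ((h / 2) ^ a * (k / 2) ^ b * √(4 / (h * k)) *
        l2norm (Icc (x0, y0) (x0 + h, y0 + k)) (pdx^[a] (pdy^[b] w))) := by
  refine (sqInt_abs_le_sqrt ((isJet_pullbackJet hh hk hU hτ hw).cont a b hab)).trans_eq ?_
  have hc : ContinuousOn (fun z => (pdx^[a] (pdy^[b] w) z) ^ 2)
      (Icc (x0, y0) (x0 + h, y0 + k)) :=
    ((contDiffOn_iterate hU (n := 0) a b (hw.of_le (by norm_cast; omega))).continuousOn.mono
      hτ).pow 2
  rw [sqInt_congr (g := fun z => ((h / 2) ^ a * (k / 2) ^ b) ^ 2 *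
    (fun z => (pdx^[a] (pdy^[b] w) z) ^ 2) (Fmap x0 y0 h k z)) fun z hz => by
      simp only [pullbackJet_eq _ _ _ hz, mul_pow], sqInt_const_mul,
    sqInt_comp_Fmap hh hk (hc.integrableOn_compact isCompact_Icc),
    Real.sqrt_mul (by positivity), Real.sqrt_mul (by positivity), Real.sqrt_sq (by positivity),
    l2norm]
  ring

lemma l2norm_le_of_abs_le {x0 y0 h k B : ℝ} (hh : 0 < h) (hk : 0 < k) (hB : 0 ≤ B)
    {f : ℝ × ℝ → ℝ} (hf : ∀ z ∈ Icc (x0, y0) (x0 + h, y0 + k), |f z| ≤ B) :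
    l2norm (Icc (x0, y0) (x0 + h, y0 + k)) f ≤ B * √(h * k) := by
  have hv : volume.real (Icc (x0, y0) (x0 + h, y0 + k)) = h * k := by
    rw [← Icc_prod_Icc, Measure.volume_eq_prod, measureReal_prod_prod, Real.volume_real_Icc_of_le,
      Real.volume_real_Icc_of_le] <;> linarith
  have h1 := norm_setIntegral_le_of_norm_le_const (μ := volume) (f := fun z => f z ^ 2)
    (s := Icc (x0, y0) (x0 + h, y0 + k)) (C := B ^ 2) isCompact_Icc.measure_lt_top
    fun z hz => by
      rw [norm_pow, Real.norm_eq_abs]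
      exact pow_le_pow_left₀ (abs_nonneg _) (hf z hz) 2
  rw [hv] at h1
  rw [l2norm, ← Real.sqrt_sq hB, ← Real.sqrt_mul (sq_nonneg _)]
  exact Real.sqrt_le_sqrt ((le_abs_self _).trans h1)

/-- The estimate for the `x`-derivative. -/
lemma exists_pdx_bound {p m : ℕ} (hp : 1 ≤ p) (hm1 : 1 ≤ m) (hm2 : m ≤ p) :
    ∃ C : ℝ, 0 < C ∧ ∀ t : Fin (p + 1) → ℝ, IsGLNodes p t →
      ∀ x0 y0 h k : ℝ, 0 < h → 0 < k → ∀ w : ℝ × ℝ → ℝ,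
        (∃ U : Set (ℝ × ℝ), IsOpen U ∧ Icc (x0, y0) (x0 + h, y0 + k) ⊆ U ∧
          ContDiffOn ℝ (m + 2 : ℕ) w U) →
      ∀ qP qd : MvPolynomial (Fin 2) ℝ,
        IsVEC (p + 1) (fun z => w (Fmap x0 y0 h k z)) qP →
        IsLag p t (fun z => ev qP z - w (Fmap x0 y0 h k z)) qd →
      l2norm (Icc (x0, y0) (x0 + h, y0 + k))
          (pdx (fun z => ev qd (Finv x0 y0 h k z) - (ev qP (Finv x0 y0 h k z) - w z))) ≤
        C * ∑ r ∈ Finset.range (m + 2), h ^ (m + 1 - r) * k ^ r *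
          l2norm (Icc (x0, y0) (x0 + h, y0 + k)) (pdx^[m + 2 - r] (pdy^[r] w)) := by
  obtain ⟨C, hC, H⟩ := exists_reference_bound hp hm1 hm2
  refine ⟨4 * C, by positivity, ?_⟩
  rintro t ht x0 y0 h k hh hk w ⟨U, hU, hτ, hw⟩ qP qd hP hd
  set τ := Icc (x0, y0) (x0 + h, y0 + k)
  set D := pullbackJet x0 y0 h k w
  have hD : IsJet (m + 2) D := isJet_pullbackJet hh hk hU hτ hw
  set J := jetNorm (m + 1) fun a b => D (a + 1) b with hJ
  have hJ0 : 0 ≤ J := jetNorm_nonneg _ _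
  have key : ∀ z ∈ τ, |pdx (fun z => ev qd (Finv x0 y0 h k z) -
      (ev qP (Finv x0 y0 h k z) - w z)) z| ≤ 2 / h * (C * J) := by
    intro z hz
    have hz' := Finv_mem hh hk hz
    obtain ⟨d, hd1, hd2⟩ := H t ht D hD (fun z => w (Fmap x0 y0 h k z))
      (fun z hz => by simp [D, pullbackJet_eq _ _ _ hz]) qP qd hP hd _ hz'.1 _ hz'.2
    have hwd := hasDerivAt_fst_slice ((hw.contDiffAt (hU.mem_nhds (hτ hz))).differentiableAt
      (by simp))
    have hF : HasDerivAt (fun s => (Finv x0 y0 h k (s, z.2)).1) (2 / h) z.1 := by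
      simp only [Finv]
      exact (((((hasDerivAt_id' z.1).sub_const x0).const_mul 2).div_const h).sub_const 1)
        |>.congr_deriv (by ring)
    have hR := ((hd1.comp (h := fun s => (Finv x0 y0 h k (s, z.2)).1) z.1 hF).add hwd).deriv
    have hDz : D 1 0 (Finv x0 y0 h k z) = h / 2 * fderiv ℝ w z (1, 0) := by
      rw [← pdx_eq_fderiv ((hw.contDiffAt (hU.mem_nhds (hτ hz))).differentiableAt (by simp))]
      simp [D, pullbackJet_eq _ _ _ hz', Fmap_Finv hh hk]
    have e : pdx (fun z => ev qd (Finv x0 y0 h k z) - (ev qP (Finv x0 y0 h k z) - w z)) z =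
        2 / h * (d + D 1 0 (Finv x0 y0 h k z)) := by
      calc _ = _ := by
            refine Eq.trans (congrArg (fun f => deriv f z.1) ?_) hR
            funext s
            simp only [Pi.add_apply, Function.comp_apply, Finv]
            ring
        _ = _ := by rw [hDz]; field_simp
    rw [e, abs_mul, abs_of_pos (by positivity)]
    exact mul_le_mul_of_nonneg_left hd2 (by positivity)
  refine (l2norm_le_of_abs_le hh hk (by positivity) key).trans ?_
  have hsq : √(h * k) * √(4 / (h * k)) = 2 := by
    rw [← Real.sqrt_mul (by positivity), mul_div_cancel₀ _ (by positivity),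
      show (4 : ℝ) = 2 ^ 2 by norm_num, Real.sqrt_sq (by norm_num)]
  have hterm : ∀ r ∈ Finset.range (m + 2),
      2 / h * √(h * k) * sqInt (fun z => |D (m + 1 - r + 1) r z|) ≤
      4 * (h ^ (m + 1 - r) * k ^ r * l2norm τ (pdx^[m + 2 - r] (pdy^[r] w))) := by
    intro r hr
    have hr' : r ≤ m + 1 := by rw [Finset.mem_range] at hr; omega
    obtain ⟨s, hs⟩ : ∃ s, m + 1 - r = s := ⟨_, rfl⟩
    have h0 : 0 ≤ l2norm τ (pdx^[s + 1] (pdy^[r] w)) := Real.sqrt_nonneg _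
    rw [show m + 2 - r = s + 1 by omega, hs]
    have h1 := sqInt_abs_pullbackJet_le hh hk hU hτ hw (a := s + 1) (b := r) (by omega)
    calc _ ≤ 2 / h * √(h * k) * (2 * ((h / 2) ^ (s + 1) * (k / 2) ^ r * √(4 / (h * k)) *
          l2norm τ (pdx^[s + 1] (pdy^[r] w)))) := mul_le_mul_of_nonneg_left h1 (by positivity)
      _ = (√(h * k) * √(4 / (h * k))) * 2 * ((h / 2) ^ s * (k / 2) ^ r *
          l2norm τ (pdx^[s + 1] (pdy^[r] w))) := by
        rw [pow_succ (h / 2)]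
        field_simp
      _ ≤ _ := by
        rw [hsq]
        have : (h / 2) ^ s * (k / 2) ^ r ≤ h ^ s * k ^ r := by gcongr <;> linarith
        nlinarith [mul_le_mul_of_nonneg_right this h0]
  calc 2 / h * (C * J) * √(h * k) = C * (2 / h * √(h * k) * J) := by ring
    _ ≤ C * (4 * ∑ r ∈ Finset.range (m + 2), h ^ (m + 1 - r) * k ^ r *
          l2norm τ (pdx^[m + 2 - r] (pdy^[r] w))) := by
      refine mul_le_mul_of_nonneg_left ?_ hC.le
      rw [hJ, jetNorm, Finset.mul_sum, Finset.mul_sum]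
      exact Finset.sum_le_sum hterm
    _ = _ := by ring

lemma ev_rename_swap (q : MvPolynomial (Fin 2) ℝ) (z : ℝ × ℝ) :
    ev (MvPolynomial.rename (Equiv.swap 0 1) q) z = ev q z.swap := by
  rw [ev, ev, MvPolynomial.eval_rename]
  congr 2
  funext i
  fin_cases i <;> simp

lemma memQ_rename_swap {k : ℕ} {q : MvPolynomial (Fin 2) ℝ} (hq : memQ k q) :
    memQ k (MvPolynomial.rename (Equiv.swap 0 1) q) := by
  have H := MvPolynomial.degreeOf_rename_of_injective (p := q) (Equiv.swap (0 : Fin 2) 1).injective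
  have h0 := H 0
  have h1 := H 1
  rw [Equiv.swap_apply_left] at h0
  rw [Equiv.swap_apply_right] at h1
  exact ⟨h1.trans_le hq.2, h0.trans_le hq.1⟩

lemma IsLag.rename_swap {k : ℕ} {s : Fin (k + 1) → ℝ} {v : ℝ × ℝ → ℝ}
    {q : MvPolynomial (Fin 2) ℝ} (h : IsLag k s v q) :
    IsLag k s (fun z => v z.swap) (MvPolynomial.rename (Equiv.swap 0 1) q) :=
  ⟨memQ_rename_swap h.1, fun i j => by rw [ev_rename_swap]; exact h.2 j i⟩

lemma continuous_ev (q : MvPolynomial (Fin 2) ℝ) : Continuous (ev q) :=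
  (MvPolynomial.continuous_eval q).comp (by
    refine continuous_pi fun i => ?_
    fin_cases i <;> simp <;> fun_prop)

lemma IsVEC.rename_swap {k : ℕ} {v : ℝ × ℝ → ℝ} {q : MvPolynomial (Fin 2) ℝ} (h : IsVEC k v q)
    (hv : ContinuousOn v (Icc (-1 : ℝ) 1 ×ˢ Icc (-1 : ℝ) 1)) :
    IsVEC k (fun z => v z.swap) (MvPolynomial.rename (Equiv.swap 0 1) q) := by
  obtain ⟨hQ, hvert, hx, hy, hcell⟩ := h
  refine ⟨memQ_rename_swap hQ, fun a ha b hb => ?_, fun b hb r hr => ?_, fun a ha r hr => ?_,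
    fun r hr => ?_⟩
  · rw [ev_rename_swap]
    exact hvert b hb a ha
  · simp only [ev_rename_swap, Prod.swap_prod_mk]
    exact hy b hb r hr
  · simp only [ev_rename_swap, Prod.swap_prod_mk]
    exact hx a ha r hr
  · have := hcell _ (memQ_rename_swap hr)
    simp only [ev_rename_swap, Prod.swap_prod_mk] at this ⊢
    rw [← this]
    refine intervalIntegral_intervalIntegral_swap (F := fun x y =>
      (ev q (y, x) - v (y, x)) * ev r (x, y)) ?_
    rw [uIoc_of_le (by norm_num)]
    refine IntegrableOn.mono_set (t := Icc (-1 : ℝ) 1 ×ˢ Icc (-1 : ℝ) 1) ?_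
      (prod_mono Ioc_subset_Icc_self Ioc_subset_Icc_self)
    refine ContinuousOn.integrableOn_compact (isCompact_Icc.prod isCompact_Icc) ?_
    have hv' : ContinuousOn (fun z : ℝ × ℝ => v (z.2, z.1)) (Icc (-1 : ℝ) 1 ×ˢ Icc (-1 : ℝ) 1) :=
      hv.comp (by fun_prop) fun z hz => ⟨hz.2, hz.1⟩
    exact (((continuous_ev q).comp continuous_swap).continuousOn.sub hv').mul
      (continuous_ev r).continuousOn

lemma iterate_comp_swap (a b : ℕ) (f : ℝ × ℝ → ℝ) :
    pdx^[a] (pdy^[b] fun z => f z.swap) = fun z => pdy^[a] (pdx^[b] f) z.swap := by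
  have hx : Function.Semiconj (fun (f : ℝ × ℝ → ℝ) z => f z.swap) pdx pdy := fun _ => rfl
  have hy : Function.Semiconj (fun (f : ℝ × ℝ → ℝ) z => f z.swap) pdy pdx := fun _ => rfl
  rw [← (hx.iterate_right b).eq, ← (hy.iterate_right a).eq]

lemma l2norm_comp_swap (x0 y0 x1 y1 : ℝ) (f : ℝ × ℝ → ℝ) :
    l2norm (Icc (y0, x0) (y1, x1)) (fun z => f z.swap) = l2norm (Icc (x0, y0) (x1, y1)) f := by
  rw [l2norm, l2norm, ← Icc_prod_Icc, ← Icc_prod_Icc, Measure.volume_eq_prod]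
  exact congrArg _ (setIntegral_prod_swap _ _ fun z => f z ^ 2)

end

/-- Anisotropic `L²`-estimate for the derivatives of
`R^τ w = I_p^τ(π_{p+1}^τ w − w) − (π_{p+1}^τ w − w)` on an arbitrary axis-parallel
rectangle `τ = [x₀,x₀+h] × [y₀,y₀+k]`:
`‖∂_x(R^τ w)‖_{L²(τ)} ≤ C Σ_{r=0}^{m+1} h^{m+1−r} k^r ‖∂_x^{m+2−r} ∂_y^r w‖_{L²(τ)}`, and
the analogous estimate for `∂_y(R^τ w)` with the roles of `h, k` and of `x, y`
interchanged, with `C` depending only on `p` and `m` (`1 ≤ m ≤ p`), independent of `h`,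
`k` and `w`.  Here `qP` is `π̂_{p+1}(w ∘ F_τ)` and `qd` is
`Î_p(π̂_{p+1}(w ∘ F_τ) − w ∘ F_τ)`, so that `R^τ w = (ev qd − (ev qP − w ∘ F_τ)) ∘ F_τ⁻¹`
on `τ`. -/
theorem R_deriv_L2_anisotropic (p m : ℕ) (hp : 2 ≤ p) (hm1 : 1 ≤ m) (hm2 : m ≤ p) :
    ∃ C : ℝ, 0 < C ∧
      ∀ t : Fin (p + 1) → ℝ, IsGLNodes p t →
      ∀ x0 y0 h k : ℝ, 0 < h → 0 < k →
      ∀ w : ℝ × ℝ → ℝ,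
        (∃ U : Set (ℝ × ℝ), IsOpen U ∧ Set.Icc (x0, y0) (x0 + h, y0 + k) ⊆ U ∧
          ContDiffOn ℝ (m + 2 : ℕ) w U) →
      ∀ qP qd : MvPolynomial (Fin 2) ℝ,
        IsVEC (p + 1) (fun z => w (Fmap x0 y0 h k z)) qP →
        IsLag p t (fun z => ev qP z - w (Fmap x0 y0 h k z)) qd →
      (l2norm (Set.Icc (x0, y0) (x0 + h, y0 + k))
          (pdx (fun z => ev qd (Finv x0 y0 h k z) - (ev qP (Finv x0 y0 h k z) - w z))) ≤
        C * ∑ r ∈ Finset.range (m + 2),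
          h ^ (m + 1 - r) * k ^ r *
            l2norm (Set.Icc (x0, y0) (x0 + h, y0 + k)) (pdx^[m + 2 - r] (pdy^[r] w))) ∧
      (l2norm (Set.Icc (x0, y0) (x0 + h, y0 + k))
          (pdy (fun z => ev qd (Finv x0 y0 h k z) - (ev qP (Finv x0 y0 h k z) - w z))) ≤
        C * ∑ r ∈ Finset.range (m + 2),
          k ^ (m + 1 - r) * h ^ r *
            l2norm (Set.Icc (x0, y0) (x0 + h, y0 + k)) (pdy^[m + 2 - r] (pdx^[r] w))) := by
  obtain ⟨C, hC, H⟩ := exists_pdx_bound (by omega : 1 ≤ p) hm1 hm2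
  refine ⟨C, hC, fun t ht x0 y0 h k hh hk w hw qP qd hP hd =>
    ⟨H t ht x0 y0 h k hh hk w hw qP qd hP hd, ?_⟩⟩
  obtain ⟨U, hU, hτ, hwU⟩ := hw
  have hv : ContinuousOn (fun z => w (Fmap x0 y0 h k z))
      (Set.Icc (-1 : ℝ) 1 ×ˢ Set.Icc (-1 : ℝ) 1) :=
    hwU.continuousOn.comp (by unfold Fmap; fun_prop) fun z hz => hτ (Fmap_mem hh hk hz)
  have key := H t ht y0 x0 k h hk hh (fun z => w z.swap)
    ⟨Prod.swap ⁻¹' U, hU.preimage continuous_swap,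
      fun z hz => hτ ⟨hz.1.symm, hz.2.symm⟩,
      hwU.comp (contDiff_snd.prodMk contDiff_fst).contDiffOn fun _ hz => hz⟩
    _ _ (hP.rename_swap hv) (by simp only [ev_rename_swap]; exact hd.rename_swap)
  simp only [iterate_comp_swap, l2norm_comp_swap, ev_rename_swap] at key
  refine le_of_eq_of_le ?_ key
  exact (l2norm_comp_swap x0 y0 (x0 + h) (y0 + k) _).symm
end

section
/- Let σ, β > 0. There exist constants C₂ ≥ C₁ > 0 depending only on σ and β such that for every integer N ≥ 4 divisible by 4 and every ε > 0, the Bakhvalov–Shishkin mesh (mesh-generating function φ(t) = −ln(1 − 2t(1 − N^{−1}))) satisfies C₁ (ln N)^{1/2} ≤ h_mesh ≤ C₂ (ln N)^{1/2}, where h_mesh := ε N^{−1} (ln N)^{1/2} / h_min, h_min := min_{1 ≤ i ≤ N/2} h_i, h_i := x_i − x_{i−1}, and x_i := (σε/β) φ(i/N) for i = 0,…,N/2. -/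
/-- Lower bound for a logarithmic increment along the points `1 - k a`, `k = j, j + 1`. -/
lemma le_neg_log_sub_neg_log {a j : ℝ} (ha : 0 ≤ a) (hj : 0 ≤ j) (h : 0 < 1 - (j + 1) * a) :
    a ≤ -Real.log (1 - (j + 1) * a) - -Real.log (1 - j * a) := by
  have hja : 0 ≤ j * a := mul_nonneg hj ha
  have hu : 0 < 1 - j * a := by linarith
  have hlog := Real.one_sub_inv_le_log_of_pos (div_pos hu h)
  rw [Real.log_div hu.ne' h.ne', inv_div] at hlog
  have hle : a ≤ 1 - (1 - (j + 1) * a) / (1 - j * a) := by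
    rw [one_sub_div hu.ne', le_div_iff₀ hu]
    nlinarith [mul_nonneg ha hja]
  linarith

/-- On `[0, 1/2]` the function `-log (1 - a)` grows at most linearly. -/
lemma neg_log_one_sub_le_two_mul {a : ℝ} (ha : 0 ≤ a) (ha' : a ≤ 1 / 2) :
    -Real.log (1 - a) ≤ 2 * a := by
  have hpos : 0 < 1 - a := by linarith
  have hlog := Real.one_sub_inv_le_log_of_pos hpos
  have hle : (1 - a)⁻¹ ≤ 1 + 2 * a := by
    rw [inv_le_iff_one_le_mul₀ hpos]
    nlinarith
  linarith

/-- For the Bakhvalov–Shishkin mesh (mesh-generating function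
`φ(t) = −ln(1 − 2t(1 − N⁻¹))`, fine mesh points `x_i = (σε/β) φ(i/N)`,
`h_i = x_i − x_{i−1}`, `h_min = min_{1 ≤ i ≤ N/2} h_i`), the mesh-specific quantity
`h_mesh = ε N⁻¹ (ln N)^{1/2} / h_min` satisfies
`C₁ (ln N)^{1/2} ≤ h_mesh ≤ C₂ (ln N)^{1/2}` with constants depending only on
`σ` and `β`. -/
theorem bakhvalov_shishkin_hmesh_bounds (σ β : ℝ) (hσ : 0 < σ) (hβ : 0 < β) :
    ∃ C₁ C₂ : ℝ, 0 < C₁ ∧ C₁ ≤ C₂ ∧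
      ∀ N : ℕ, 4 ≤ N → 4 ∣ N → ∀ ε : ℝ, 0 < ε →
        let x : ℕ → ℝ := fun i =>
          σ * ε / β * (-Real.log (1 - 2 * ((i : ℝ) / N) * (1 - (N : ℝ)⁻¹)))
        let hmin : ℝ := sInf ((fun i : ℕ => x i - x (i - 1)) '' {i | 1 ≤ i ∧ i ≤ N / 2})
        let hmesh : ℝ := ε * (N : ℝ)⁻¹ * Real.sqrt (Real.log N) / hmin
        C₁ * Real.sqrt (Real.log N) ≤ hmesh ∧
          hmesh ≤ C₂ * Real.sqrt (Real.log N) := by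
  refine ⟨β / (4 * σ), β / σ, by positivity, by gcongr; linarith, ?_⟩
  intro N hN _ ε hε x hmin hmesh
  have hN' : (4 : ℝ) ≤ N := by exact_mod_cast hN
  have hN0 : (0 : ℝ) < N := by linarith
  have hinv0 : 0 < (N : ℝ)⁻¹ := by positivity
  have hinv : (N : ℝ)⁻¹ ≤ 1 / 4 := by
    rw [inv_le_comm₀ hN0 (by norm_num)]
    norm_num [hN']
  set c : ℝ := σ * ε / β with hc
  have hc0 : 0 < c := by positivity
  obtain ⟨a, ha⟩ : ∃ a : ℝ, a = 2 * (N : ℝ)⁻¹ * (1 - (N : ℝ)⁻¹) := ⟨_, rfl⟩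
  have ha_lower : (N : ℝ)⁻¹ ≤ a := by rw [ha]; nlinarith
  have ha_upper : a ≤ 2 * (N : ℝ)⁻¹ := by rw [ha]; nlinarith
  have hx : ∀ i : ℕ, x i = c * -Real.log (1 - i * a) := fun i => by
    simp only [x, ha, hc, div_eq_mul_inv]
    ring_nf
  have hlower : ∀ y ∈ (fun i : ℕ => x i - x (i - 1)) '' {i | 1 ≤ i ∧ i ≤ N / 2},
      c * (N : ℝ)⁻¹ ≤ y := by
    rintro _ ⟨i, ⟨hi, hi'⟩, rfl⟩
    obtain ⟨j, rfl⟩ := Nat.exists_eq_add_of_le' hi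
    have hj : ((j : ℝ) + 1) * 2 ≤ N := by
      exact_mod_cast (Nat.le_div_iff_mul_le two_pos).mp hi'
    have hpos : 0 < 1 - ((j : ℝ) + 1) * a := by
      have hle : ((j : ℝ) + 1) * a ≤ 1 - (N : ℝ)⁻¹ := by
        calc ((j : ℝ) + 1) * a = ((j + 1) * 2) * ((N : ℝ)⁻¹ * (1 - (N : ℝ)⁻¹)) := by
              rw [ha]; ring
          _ ≤ N * ((N : ℝ)⁻¹ * (1 - (N : ℝ)⁻¹)) :=
              mul_le_mul_of_nonneg_right hj (mul_nonneg hinv0.le (by linarith))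
          _ = 1 - (N : ℝ)⁻¹ := mul_inv_cancel_left₀ hN0.ne' _
      linarith
    have hstep := le_neg_log_sub_neg_log (hinv0.le.trans ha_lower) j.cast_nonneg hpos
    simp only [hx, Nat.add_sub_cancel, Nat.cast_add, Nat.cast_one]
    rw [← mul_sub]
    exact mul_le_mul_of_nonneg_left (ha_lower.trans hstep) hc0.le
  have hmem : x 1 - x (1 - 1) ∈ (fun i : ℕ => x i - x (i - 1)) '' {i | 1 ≤ i ∧ i ≤ N / 2} :=
    ⟨1, ⟨le_rfl, by omega⟩, rfl⟩
  have hmin_lower : c * (N : ℝ)⁻¹ ≤ hmin := le_csInf ⟨_, hmem⟩ hlower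
  have hmin_upper : hmin ≤ c * (4 * (N : ℝ)⁻¹) := by
    refine (csInf_le ⟨_, hlower⟩ hmem).trans ?_
    have hlog := neg_log_one_sub_le_two_mul (hinv0.le.trans ha_lower) (by linarith)
    simp only [hx, Nat.sub_self, Nat.cast_one, Nat.cast_zero, one_mul, zero_mul, sub_zero,
      Real.log_one, neg_zero, mul_zero]
    exact mul_le_mul_of_nonneg_left (by linarith) hc0.le
  have hmin0 : 0 < hmin := (mul_pos hc0 hinv0).trans_le hmin_lower
  have hs : 0 ≤ Real.sqrt (Real.log N) := Real.sqrt_nonneg _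
  have hβc : β / σ * c = ε := by rw [hc]; field_simp
  constructor
  · rw [le_div_iff₀ hmin0]
    calc β / (4 * σ) * Real.sqrt (Real.log N) * hmin
        ≤ β / (4 * σ) * Real.sqrt (Real.log N) * (c * (4 * (N : ℝ)⁻¹)) := by gcongr
      _ = β / σ * c * (N : ℝ)⁻¹ * Real.sqrt (Real.log N) := by field_simp
      _ = ε * (N : ℝ)⁻¹ * Real.sqrt (Real.log N) := by rw [hβc]
  · rw [div_le_iff₀ hmin0]
    calc ε * (N : ℝ)⁻¹ * Real.sqrt (Real.log N)
        = β / σ * Real.sqrt (Real.log N) * (c * (N : ℝ)⁻¹) := by rw [← hβc]; ring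
      _ ≤ β / σ * Real.sqrt (Real.log N) * hmin := by gcongr
end
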